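/- arXiv:2602.05412 — 5 statements merged into one kernel-verified Lean document; each statement's English description precedes it below -/
import Mathlib

section
/- Let G be a finite group with identity e, let H be a proper subgroup of G, and let S ⊆ G satisfy e ∉ S, S = S⁻¹, and H∖{e} ⊆ S. Set T = S ∖ (H∖{e}), and let m ≥ 1 and λ ≥ 0 be integers. Then the Cayley graph Γ = Cay(G,S) is edge-regular with parameters (|G|, |S|, λ) and the subgroup H is an m-regular clique of Γ of size |H| if and only if the following three conditions hold: (1) |T ∩ Hg| = m for every g ∈ G∖H; (2) |Th ∩ T| = λ − |H| + 2 for every h ∈ H∖{e}; (3) |Tg ∩ T| = λ − 2m + 2 for every g ∈ T. -/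
/-- The Cayley graph of a group `G` with connection set `S`:
distinct vertices `x, y` are adjacent iff `y * x⁻¹ ∈ S` (symmetrised). -/
def cayley {G : Type*} [Group G] (S : Set G) : SimpleGraph G :=
  SimpleGraph.fromRel (fun x y => y * x⁻¹ ∈ S)

/-- A graph is edge-regular with parameters `(v, k, l)` if it has `v` vertices,
every vertex has degree `k`, and every two adjacent vertices have exactly `l`
common neighbours. -/
def IsEdgeRegularWith {V : Type*} (G : SimpleGraph V) (v k l : ℕ) : Prop :=
  Nat.card V = v ∧ (∀ x : V, (G.neighborSet x).ncard = k) ∧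
    ∀ x y : V, G.Adj x y → (G.commonNeighbors x y).ncard = l

/-- A clique `C` is `m`-regular if every vertex not in `C` is adjacent to
exactly `m` vertices of `C`. -/
def IsRegularClique {V : Type*} (G : SimpleGraph V) (C : Set V) (m : ℕ) : Prop :=
  G.IsClique C ∧ ∀ x ∉ C, (G.neighborSet x ∩ C).ncard = m

theorem cayley_adj {G : Type*} [Group G] {S : Set G} (heS : (1 : G) ∉ S) (hSinv : S = S⁻¹)
    (x y : G) : (cayley S).Adj x y ↔ y * x⁻¹ ∈ S := by
  have hinv : x * y⁻¹ ∈ S ↔ y * x⁻¹ ∈ S := by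
    conv_lhs => rw [hSinv]
    simp
  simp only [cayley, SimpleGraph.fromRel_adj, hinv, or_self, and_iff_right_iff_imp]
  rintro h rfl
  exact heS (by simpa using h)

theorem cayley_neighborSet {G : Type*} [Group G] {S : Set G} (heS : (1 : G) ∉ S)
    (hSinv : S = S⁻¹) (x : G) : (cayley S).neighborSet x = (fun s => s * x) '' S := by
  ext y
  simp [cayley_adj heS hSinv, Set.image_mul_right]

theorem ncard_image_mul_right {G : Type*} [Group G] (A : Set G) (x : G) :
    ((fun s => s * x) '' A).ncard = A.ncard :=
  Set.ncard_image_of_injective _ (mul_left_injective x)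

theorem cayley_ncard_commonNeighbors {G : Type*} [Group G] {S : Set G} (heS : (1 : G) ∉ S)
    (hSinv : S = S⁻¹) (x y : G) :
    ((cayley S).commonNeighbors x y).ncard =
      (((fun s => s * (y * x⁻¹)) '' S) ∩ S).ncard := by
  rw [← ncard_image_mul_right (((fun s => s * (y * x⁻¹)) '' S) ∩ S) x]
  congr 1
  ext z
  simp [SimpleGraph.mem_commonNeighbors, cayley_adj heS hSinv, Set.image_mul_right,
    mul_assoc, and_comm]

/-- The Cayley graph of `S` is edge-regular exactly when every translate of `S` by an element
of `S` meets `S` in `l` elements. -/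
theorem cayley_isEdgeRegularWith_iff {G : Type*} [Group G] {S : Set G} (heS : (1 : G) ∉ S)
    (hSinv : S = S⁻¹) (l : ℕ) :
    IsEdgeRegularWith (cayley S) (Nat.card G) S.ncard l ↔
      ∀ g ∈ S, (((fun s => s * g) '' S) ∩ S).ncard = l := by
  constructor
  · rintro ⟨-, -, h⟩ g hg
    have := h 1 g (by simpa [cayley_adj heS hSinv] using hg)
    simpa [cayley_ncard_commonNeighbors heS hSinv] using this
  · refine fun h => ⟨rfl, fun x => ?_, fun x y hxy => ?_⟩
    · rw [cayley_neighborSet heS hSinv, ncard_image_mul_right]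
    · rw [cayley_ncard_commonNeighbors heS hSinv]
      exact h _ ((cayley_adj heS hSinv x y).1 hxy)

/-- A subgroup whose nontrivial elements lie in `S` is an `m`-regular clique of the Cayley graph
of `S` exactly when every nontrivial right coset meets `S` in `m` elements. -/
theorem cayley_isRegularClique_iff {G : Type*} [Group G] {S : Set G} (heS : (1 : G) ∉ S)
    (hSinv : S = S⁻¹) (H : Subgroup G) (hHS : (H : Set G) \ {1} ⊆ S) (m : ℕ) :
    IsRegularClique (cayley S) (H : Set G) m ↔
      ∀ g : G, g ∉ H → {s ∈ S | s * g⁻¹ ∈ H}.ncard = m := by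
  have hclique : (cayley S).IsClique (H : Set G) := by
    intro x hx y hy hxy
    rw [cayley_adj heS hSinv]
    exact hHS ⟨H.mul_mem hy (H.inv_mem hx), fun h => hxy (mul_inv_eq_one.1 h).symm⟩
  have hcount : ∀ g : G, ((cayley S).neighborSet g ∩ (H : Set G)).ncard =
      {s ∈ S | s * g⁻¹⁻¹ ∈ H}.ncard := by
    intro g
    rw [← ncard_image_mul_right {s ∈ S | s * g⁻¹⁻¹ ∈ H} g]
    congr 1
    ext z
    simp [cayley_adj heS hSinv, Set.image_mul_right]
  constructor
  · rintro ⟨-, h⟩ g hg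
    have := h g⁻¹ (by simpa using hg)
    rwa [hcount, inv_inv] at this
  · refine fun h => ⟨hclique, fun x hx => ?_⟩
    rw [hcount]
    exact h x⁻¹ (by simpa using hx)

theorem ncard_translate_inter_of_mem {G : Type*} [Group G] [Finite G] (H : Subgroup G)
    {S T : Set G} (hST : S = T ∪ ((H : Set G) \ {1})) (hTH : ∀ t ∈ T, t ∉ H)
    {h : G} (hh : h ∈ H) (h1 : h ≠ 1) :
    (((fun s => s * h) '' S) ∩ S).ncard + 2 =
      (((fun t => t * h) '' T) ∩ T).ncard + Nat.card H := by
  have hsplit : ((fun s => s * h) '' S) ∩ S =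
      (((fun t => t * h) '' T) ∩ T) ∪ ((H : Set G) \ {1, h}) := by
    ext z
    have hz : z * h⁻¹ ∈ H ↔ z ∈ H := H.mul_mem_cancel_right (H.inv_mem hh)
    have h2 : z * h⁻¹ ∈ T → z ∉ H := fun ht => hz.not.1 (hTH _ ht)
    have h3 := hTH z
    simp only [hST, Set.image_mul_right, Set.mem_inter_iff, Set.mem_preimage, Set.mem_union,
      Set.mem_sdiff, Set.mem_singleton_iff, Set.mem_insert_iff, SetLike.mem_coe, hz,
      mul_inv_eq_one]
    tauto
  have hdisj : Disjoint (((fun t => t * h) '' T) ∩ T) ((H : Set G) \ {1, h}) :=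
    Set.disjoint_left.2 fun z hz hz' => hTH z hz.2 hz'.1
  have hcard : ((H : Set G) \ {1, h}).ncard + ({1, h} : Set G).ncard = (H : Set G).ncard :=
    Set.ncard_sdiff_add_ncard_of_subset (Set.insert_subset H.one_mem (by simpa using hh))
  rw [Set.ncard_pair h1.symm] at hcard
  rw [hsplit, Set.ncard_union_eq hdisj, add_assoc, hcard]
  rfl

theorem ncard_translate_inter_of_notMem {G : Type*} [Group G] [Finite G] (H : Subgroup G)
    {S T : Set G} (hST : S = T ∪ ((H : Set G) \ {1})) (hTH : ∀ t ∈ T, t ∉ H)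
    {g : G} (hg : g ∈ T) (hg' : g⁻¹ ∈ T) :
    (((fun s => s * g) '' S) ∩ S).ncard + 2 = (((fun t => t * g) '' T) ∩ T).ncard +
      {t ∈ T | t * g⁻¹ ∈ H}.ncard + {t ∈ T | t * g⁻¹⁻¹ ∈ H}.ncard := by
  set A := {t ∈ T | t * g⁻¹ ∈ H} with hA
  set B := (fun t => t * g) '' {t ∈ T | t * g⁻¹⁻¹ ∈ H} with hB
  have hBmem : ∀ z, z ∈ B ↔ z * g⁻¹ ∈ T ∧ z ∈ H := by
    intro z
    simp [hB, Set.image_mul_right]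
  have hgA : g ∈ A := ⟨hg, by simp⟩
  have h1B : (1 : G) ∈ B := (hBmem 1).2 ⟨by simpa using hg', H.one_mem⟩
  have hsplit : ((fun s => s * g) '' S) ∩ S =
      ((((fun t => t * g) '' T) ∩ T) ∪ (A \ {g})) ∪ (B \ {1}) := by
    ext z
    have h2 := hTH (z * g⁻¹)
    have h3 := hTH z
    have h4 : z ∈ H → z * g⁻¹ ∉ H := fun hz hzg =>
      hTH _ hg' ((H.mul_mem_cancel_left hz).1 hzg)
    simp only [hST, hA, hBmem, Set.image_mul_right, Set.mem_inter_iff, Set.mem_preimage,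
      Set.mem_union, Set.mem_sdiff, Set.mem_singleton_iff, Set.mem_ofPred_eq, SetLike.mem_coe,
      mul_inv_eq_one]
    tauto
  have hdisj : Disjoint (((fun t => t * g) '' T) ∩ T) (A \ {g}) := by
    refine Set.disjoint_left.2 fun z hz hz' => hTH (z * g⁻¹) ?_ hz'.1.2
    simpa [Set.image_mul_right] using hz.1
  have hdisj' : Disjoint ((((fun t => t * g) '' T) ∩ T) ∪ (A \ {g})) (B \ {1}) := by
    refine Set.disjoint_left.2 fun z hz hz' => hTH z ?_ ((hBmem z).1 hz'.1).2
    exact hz.elim (fun h => h.2) (fun h => h.1.1)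
  have hAcard := Set.ncard_sdiff_singleton_add_one hgA
  have hBcard := Set.ncard_sdiff_singleton_add_one h1B
  rw [hsplit, Set.ncard_union_eq hdisj', Set.ncard_union_eq hdisj,
    ← ncard_image_mul_right {t ∈ T | t * g⁻¹⁻¹ ∈ H} g, ← hB]
  omega

theorem statement0 {G : Type*} [Group G] [Finite G]
    (H : Subgroup G) (hH : H ≠ ⊤)
    (S : Set G) (heS : (1 : G) ∉ S) (hSinv : S = S⁻¹)
    (hHS : (H : Set G) \ {1} ⊆ S)
    (T : Set G) (hT : T = S \ ((H : Set G) \ {1}))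
    (m lam : ℕ) (hm : 1 ≤ m) :
    (IsEdgeRegularWith (cayley S) (Nat.card G) S.ncard lam ∧
      IsRegularClique (cayley S) (H : Set G) m) ↔
    ((∀ g : G, g ∉ H → {t ∈ T | t * g⁻¹ ∈ H}.ncard = m) ∧
     (∀ h ∈ H, h ≠ (1 : G) →
        ((((fun t => t * h) '' T) ∩ T).ncard : ℤ) = (lam : ℤ) - Nat.card H + 2) ∧
     (∀ g ∈ T, ((((fun t => t * g) '' T) ∩ T).ncard : ℤ) = (lam : ℤ) - 2 * m + 2)) := by
  have hTH : ∀ t ∈ T, t ∉ H := by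
    rw [hT]
    exact fun t ht htH => ht.2 ⟨htH, fun h => heS (h ▸ ht.1)⟩
  have hST : S = T ∪ ((H : Set G) \ {1}) := by
    rw [hT, Set.sdiff_union_of_subset hHS]
  have hTinv : ∀ g ∈ T, g⁻¹ ∈ T := by
    rw [hT]
    rintro g ⟨hgS, hgH⟩
    refine ⟨?_, fun h => hgH ⟨?_, ?_⟩⟩
    · rw [hSinv]
      simpa using hgS
    · simpa using h.1
    · simpa using h.2
  have hcoset : ∀ g : G, g ∉ H → {s ∈ S | s * g⁻¹ ∈ H} = {t ∈ T | t * g⁻¹ ∈ H} := by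
    intro g hg
    ext z
    have hz : z * g⁻¹ ∈ H → z ∉ H := fun hzg hzH =>
      hg (H.inv_mem_iff.1 ((H.mul_mem_cancel_left hzH).1 hzg))
    simp only [hST, Set.mem_ofPred_eq, Set.mem_union, Set.mem_sdiff, SetLike.mem_coe]
    tauto
  rw [cayley_isEdgeRegularWith_iff heS hSinv, cayley_isRegularClique_iff heS hSinv H hHS, and_comm]
  rw [forall₂_congr fun g hg => by rw [hcoset g hg]]
  refine and_congr_right fun hm => ?_
  have hmem : ∀ h ∈ H, h ≠ 1 → ((((fun s => s * h) '' S) ∩ S).ncard = lam ↔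
      ((((fun t => t * h) '' T) ∩ T).ncard : ℤ) = (lam : ℤ) - Nat.card H + 2) := by
    intro h hh h1
    have := ncard_translate_inter_of_mem H hST hTH hh h1
    omega
  have hnotMem : ∀ g ∈ T, ((((fun s => s * g) '' S) ∩ S).ncard = lam ↔
      ((((fun t => t * g) '' T) ∩ T).ncard : ℤ) = (lam : ℤ) - 2 * m + 2) := by
    intro g hg
    have := ncard_translate_inter_of_notMem H hST hTH hg (hTinv g hg)
    rw [hm g (hTH g hg), hm g⁻¹ (hTH _ (hTinv g hg))] at this
    omega
  constructor
  · intro hS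
    exact ⟨fun h hh h1 => (hmem h hh h1).1 (hS h (hHS ⟨hh, h1⟩)),
      fun g hg => (hnotMem g hg).1 (hS g (hST ▸ Or.inl hg))⟩
  · rintro ⟨hH', hT'⟩ g hg
    rw [hST] at hg
    rcases hg with hg | hg
    · exact (hnotMem g hg).2 (hT' g hg)
    · exact (hmem g hg.1 hg.2).2 (hH' g hg.1 hg.2)
end

section
/- Let G be a finite group with identity e, let H be a proper subgroup of G, and let S ⊆ G satisfy e ∉ S, S = S⁻¹, and H∖{e} ⊆ S. Set T = S ∖ (H∖{e}), s = |H|, n = [G:H], and suppose that for integers m ≥ 1 and λ ≥ 0: |T ∩ Hg| = m for every g ∈ G∖H, |Th ∩ T| = λ − s + 2 for every h ∈ H∖{e}, and |Tg ∩ T| = λ − 2m + 2 for every g ∈ T. Then |G| = n·s, |S| = s − 1 + (n−1)m, and (λ − s + 2)(s − 1) = (n−1)m(m−1), i.e. λ = s − 2 + (n−1)m(m−1)/(s−1). -/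
open Finset in
open scoped Classical in
/-- Double counting the pairs `(g, t)` with `t ∈ T` and `t ∈ H g`. -/
theorem sum_card_filter_rightCoset {G : Type*} [Group G] [Fintype G] (H : Subgroup G)
    (T : Finset G) :
    ∑ g : G, #{t ∈ T | t * g⁻¹ ∈ H} = #T * Nat.card H := by
  simp only [card_filter]
  rw [sum_comm, card_eq_sum_ones, sum_mul]
  refine sum_congr rfl fun t _ => ?_
  rw [← card_filter, one_mul, ← SetLike.coe_sort_coe, Nat.card_coe_set_eq,
    Set.ncard_eq_toFinset_card']
  refine card_bij' (fun g _ => t * g⁻¹) (fun h _ => h⁻¹ * t) ?_ ?_ ?_ ?_ <;> simp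

open Finset in
open scoped Classical in
/-- Double counting the pairs of distinct elements of `T` lying in a common coset of `H`. -/
theorem sum_card_filter_mul_inv_mem {G : Type*} [Group G] [Fintype G] (H : Subgroup G)
    (T : Finset G) (hT : ∀ t ∈ T, t⁻¹ ∈ T) :
    ∑ h : G with h ∈ H ∧ h ≠ 1, #{t ∈ T | t * h⁻¹ ∈ T} =
      ∑ t ∈ T, (#{u ∈ T | u * t ∈ H} - 1) := by
  have hT' : ∀ t, t⁻¹ ∈ T ↔ t ∈ T := fun t => ⟨fun h => by simpa using hT _ h, hT t⟩
  rw [sum_congr rfl fun h _ => card_filter (fun t => t * h⁻¹ ∈ T) T, sum_comm]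
  refine sum_congr rfl fun t ht => ?_
  have hmem : t⁻¹ ∈ ({u ∈ T | u * t ∈ H} : Finset G) := by simp [hT t ht, H.one_mem]
  rw [← card_filter, ← card_erase_of_mem hmem]
  refine card_bij' (fun h _ => h * t⁻¹) (fun u _ => u * t) ?_ ?_ ?_ ?_
  · intro h hh
    simp only [mem_filter, mem_univ, true_and, mem_erase] at hh ⊢
    refine ⟨by simpa using hh.1.2, ?_, by simpa using hh.1.1⟩
    rw [← hT']
    simpa using hh.2
  · intro u hu
    simp only [mem_filter, mem_univ, true_and, mem_erase] at hu ⊢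
    exact ⟨⟨hu.2.2, fun h => hu.1 (eq_inv_of_mul_eq_one_left h)⟩, by simpa using hT u hu.2.1⟩
  · simp
  · simp

theorem statement1 {G : Type*} [Group G] [Finite G]
    (H : Subgroup G) (hH : H ≠ ⊤)
    (S : Set G) (heS : (1 : G) ∉ S) (hSinv : S = S⁻¹)
    (hHS : (H : Set G) \ {1} ⊆ S)
    (T : Set G) (hT : T = S \ ((H : Set G) \ {1}))
    (s n : ℕ) (hs : s = Nat.card H) (hn : n = H.index)
    (m lam : ℕ) (hm : 1 ≤ m)
    (h1 : ∀ g : G, g ∉ H → {t ∈ T | t * g⁻¹ ∈ H}.ncard = m)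
    (h2 : ∀ h ∈ H, h ≠ (1 : G) →
        ((((fun t => t * h) '' T) ∩ T).ncard : ℤ) = (lam : ℤ) - s + 2)
    (h3 : ∀ g ∈ T, ((((fun t => t * g) '' T) ∩ T).ncard : ℤ) = (lam : ℤ) - 2 * m + 2) :
    Nat.card G = n * s ∧
    (S.ncard : ℤ) = (s : ℤ) - 1 + ((n : ℤ) - 1) * m ∧
    ((lam : ℤ) - s + 2) * ((s : ℤ) - 1) = ((n : ℤ) - 1) * m * ((m : ℤ) - 1) := by
  classical
  have := Fintype.ofFinite G
  have hG : Nat.card G = n * s := by rw [hs, hn, H.index_mul_card]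
  have hs0 : 0 < s := hs ▸ Nat.card_pos
  have hTH : ∀ t ∈ T, t ∉ H := by
    rintro t ht htH
    rw [hT] at ht
    exact ht.2 ⟨htH, fun h => heS (h ▸ ht.1)⟩
  have hTinv : ∀ t ∈ T, t⁻¹ ∈ T := by
    intro t ht
    have htH := hTH t ht
    rw [hT] at ht ⊢
    refine ⟨?_, fun h => htH (by simpa using h.1)⟩
    rw [hSinv]
    simpa using ht.1
  have hcoset : ∀ g ∉ H, (Finset.card {t ∈ T.toFinset | t * g⁻¹ ∈ H}) = m := by
    intro g hg
    rw [← h1 g hg, ← Set.ncard_coe_finset]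
    simp
  have hHcard : (Finset.card {h : G | h ∈ H}) = s := by
    rw [hs, ← SetLike.coe_sort_coe, Nat.card_coe_set_eq, ← Set.ncard_coe_finset]
    simp
  have hTcard : (T.ncard : ℤ) = ((n : ℤ) - 1) * m := by
    have hcount := sum_card_filter_rightCoset H T.toFinset
    have hsum : ∑ g : G, (Finset.card {t ∈ T.toFinset | t * g⁻¹ ∈ H}) = (Finset.card {g : G | g ∉ H}) * m := by
      rw [← Finset.sum_filter_add_sum_filter_not Finset.univ (· ∈ H),
        Finset.sum_eq_zero, zero_add, Finset.sum_const_nat]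
      · intro g hg
        exact hcoset g (by simpa using hg)
      · intro g hg
        simp only [Finset.mem_filter, Finset.mem_univ, true_and] at hg
        rw [Finset.card_eq_zero, Finset.filter_eq_empty_iff]
        intro t ht
        rw [H.mul_mem_cancel_right (H.inv_mem hg)]
        exact hTH t (by simpa using ht)
    have hcompl : s + (Finset.card {g : G | g ∉ H}) = n * s := by
      rw [← hG, ← hHcard, Finset.card_filter_add_card_filter_not, Nat.card_eq_fintype_card,
        Finset.card_univ]
    rw [hsum, ← Set.ncard_eq_toFinset_card', ← hs] at hcount
    zify at hcount hcompl
    refine mul_right_cancel₀ (b := (s : ℤ)) (by positivity) ?_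
    linear_combination -hcount + (m : ℤ) * hcompl
  have hHone : (((Finset.card {h : G | h ∈ H ∧ h ≠ 1}) : ℕ) : ℤ) = (s : ℤ) - 1 := by
    have hmem : (1 : G) ∈ ({h : G | h ∈ H} : Finset G) := by simp [H.one_mem]
    have herase : ({h : G | h ∈ H ∧ h ≠ 1} : Finset G) =
        ({h : G | h ∈ H} : Finset G).erase 1 := by
      ext h
      simp [and_comm]
    rw [herase, Finset.card_erase_of_mem hmem, hHcard, Nat.cast_sub hs0, Nat.cast_one]
  refine ⟨hG, ?_, ?_⟩
  · have hHncard : ((H : Set G) \ {1}).ncard = (Finset.card {h : G | h ∈ H ∧ h ≠ 1}) := by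
      rw [← Set.ncard_coe_finset]
      congr 1
      ext
      simp
    have hsplit := Set.ncard_sdiff_add_ncard_of_subset hHS
    rw [← hT, hHncard] at hsplit
    zify at hsplit
    linear_combination -hsplit + hTcard + hHone
  · have hcount := sum_card_filter_mul_inv_mem H T.toFinset (by simpa using hTinv)
    have hright : ∑ t ∈ T.toFinset, ((Finset.card {u ∈ T.toFinset | u * t ∈ H}) - 1) = T.ncard * (m - 1) := by
      rw [Set.ncard_eq_toFinset_card', Finset.sum_const_nat]
      intro t ht
      have htH : t⁻¹ ∉ H := by simpa using hTH t (by simpa using ht)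
      rw [← hcoset t⁻¹ htH, inv_inv]
    have hleft : ∀ h ∈ ({h : G | h ∈ H ∧ h ≠ 1} : Finset G),
        (((Finset.card {t ∈ T.toFinset | t * h⁻¹ ∈ T.toFinset}) : ℕ) : ℤ) = (lam : ℤ) - s + 2 := by
      intro h hh
      simp only [Finset.mem_filter, Finset.mem_univ, true_and] at hh
      rw [← h2 h hh.1 hh.2, ← Set.ncard_coe_finset]
      congr 2
      ext t
      simp [and_comm]
    rw [hright] at hcount
    zify [hm] at hcount
    rw [Finset.sum_congr rfl hleft, Finset.sum_const, nsmul_eq_mul, hHone, hTcard] at hcount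
    linear_combination hcount
end

section
/- For every even positive integer n and every finite abelian group G of order 2^{2n+2} that contains a subgroup of index 2 which is elementary abelian (i.e. of exponent 2), there exists a subset S ⊆ G with e ∉ S and S = S⁻¹ such that the Cayley graph Cay(G,S) is a strictly Neumaier graph with parameters (2^{2n+2}, (2^{n+1}−1)(2^n+1), 2(2^n−1)(2^{n−1}+1), 2^n, 2^{n+1}); that is, Cay(G,S) is non-complete, edge-regular with parameters (2^{2n+2}, (2^{n+1}−1)(2^n+1), 2(2^n−1)(2^{n−1}+1)), contains a 2^n-regular clique of size 2^{n+1}, and is not strongly regular. -/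
/-- A Neumaier graph with parameters `(v, k, l, m, s)`: a non-complete
edge-regular graph with parameters `(v, k, l)` containing an `m`-regular clique
of size `s`. -/
def IsNeumaierWith {V : Type*} (G : SimpleGraph V) (v k l m s : ℕ) : Prop :=
  G ≠ ⊤ ∧ IsEdgeRegularWith G v k l ∧ ∃ C : Set V, IsRegularClique G C m ∧ C.ncard = s

/-- A graph is strongly regular if it is non-complete, regular, every two
adjacent vertices have the same number of common neighbours, and every two
distinct non-adjacent vertices have the same number of common neighbours. -/
def IsStronglyRegular {V : Type*} (G : SimpleGraph V) : Prop :=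
  G ≠ ⊤ ∧ (∃ k, ∀ x : V, (G.neighborSet x).ncard = k) ∧
    (∃ l, ∀ x y : V, G.Adj x y → (G.commonNeighbors x y).ncard = l) ∧
    (∃ μ, ∀ x y : V, x ≠ y → ¬G.Adj x y → (G.commonNeighbors x y).ncard = μ)

open Finset

section SignFunctions

variable {G : Type*} [Group G]

/-- The nonidentity elements at which a sign function takes the value `1`. -/
def signSet (g : G → ℤ) : Set G := {x | x ≠ 1 ∧ g x = 1}

theorem signSet_inv {g : G → ℤ} (hinv : ∀ x, g x⁻¹ = g x) : signSet g = (signSet g)⁻¹ := by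
  ext x
  simp [signSet, hinv]

theorem cayley_signSet_adj {g : G → ℤ} (hinv : ∀ x, g x⁻¹ = g x) (x y : G) :
    (cayley (signSet g)).Adj x y ↔ x ≠ y ∧ g (y * x⁻¹) = 1 := by
  have h : g (x * y⁻¹) = g (y * x⁻¹) := by rw [← hinv (y * x⁻¹)]; simp
  simp only [cayley, SimpleGraph.fromRel_adj, signSet, Set.mem_ofPred_eq, h, ne_eq,
    mul_inv_eq_one]
  tauto

theorem two_mul_card_filter_sign {α : Type*} (s : Finset α) (g : α → ℤ)
    (hg : ∀ x, g x = 1 ∨ g x = -1) :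
    2 * (#{x ∈ s | g x = 1} : ℤ) = #s + ∑ x ∈ s, g x := by
  have h : (#s : ℤ) = ∑ _x ∈ s, (1 : ℤ) := by simp
  rw [h, card_filter, ← sum_add_distrib]
  push_cast
  rw [mul_sum]
  refine sum_congr rfl fun x _ => ?_
  rcases hg x with h | h <;> simp [h]

theorem four_mul_card_filter_sign {α : Type*} (s : Finset α) (g h : α → ℤ)
    (hg : ∀ x, g x = 1 ∨ g x = -1) (hh : ∀ x, h x = 1 ∨ h x = -1) :
    4 * (#{x ∈ s | g x = 1 ∧ h x = 1} : ℤ) =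
      #s + ∑ x ∈ s, g x + ∑ x ∈ s, h x + ∑ x ∈ s, g x * h x := by
  have e : (#s : ℤ) = ∑ _x ∈ s, (1 : ℤ) := by simp
  rw [e, card_filter, ← sum_add_distrib, ← sum_add_distrib, ← sum_add_distrib]
  push_cast
  rw [mul_sum]
  refine sum_congr rfl fun x _ => ?_
  rcases hg x with h1 | h1 <;> rcases hh x with h2 | h2 <;> simp [h1, h2]

variable {g : G → ℤ}

theorem two_mul_neighbors_inter (hg : ∀ x, g x = 1 ∨ g x = -1)
    (hinv : ∀ x, g x⁻¹ = g x) {C : Finset G} {x : G} (hx : x ∉ C) :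
    2 * ((((cayley (signSet g)).neighborSet x ∩ C).ncard : ℕ) : ℤ) =
      #C + ∑ w ∈ C, g (w * x⁻¹) := by
  classical
  have e : (cayley (signSet g)).neighborSet x ∩ C = ({w ∈ C | g (w * x⁻¹) = 1} : Finset G) := by
    ext w
    by_cases h : w = x
    · simp [h, hx]
    · simp [cayley_signSet_adj hinv, Ne.symm h, and_comm]
  rw [e, Set.ncard_coe_finset]
  exact two_mul_card_filter_sign C (fun w => g (w * x⁻¹)) (fun w => hg _)

variable [Fintype G]

theorem two_mul_degree_cayley_signSet (hg : ∀ x, g x = 1 ∨ g x = -1) (h1 : g 1 = 1)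
    (hinv : ∀ x, g x⁻¹ = g x) (x : G) :
    2 * (((cayley (signSet g)).neighborSet x).ncard + 1 : ℤ) =
      Nat.card G + ∑ u, g u := by
  classical
  have e : insert x ((cayley (signSet g)).neighborSet x) =
      ({y | g (y * x⁻¹) = 1} : Finset G) := by
    ext y
    by_cases h : y = x
    · simp [h, h1]
    · simp [h, cayley_signSet_adj hinv, Ne.symm h]
  have hc := congrArg Set.ncard e
  rw [Set.ncard_insert_of_notMem (by simp), Set.ncard_coe_finset] at hc
  have h2 := two_mul_card_filter_sign univ (fun y => g (y * x⁻¹)) (fun y => hg _)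
  rw [← hc, show ∑ w, g (w * x⁻¹) = ∑ u, g u from Equiv.sum_comp (Equiv.mulRight x⁻¹) g] at h2
  simpa [Nat.card_eq_fintype_card] using h2

theorem four_mul_card_filter_translates (hg : ∀ x, g x = 1 ∨ g x = -1) (x y : G) :
    4 * (#{w : G | g (w * x⁻¹) = 1 ∧ g (w * y⁻¹) = 1} : ℤ) =
      Nat.card G + 2 * ∑ u, g u + ∑ u, g u * g (u * (x * y⁻¹)) := by
  have h := four_mul_card_filter_sign univ (fun w => g (w * x⁻¹)) (fun w => g (w * y⁻¹))
    (fun w => hg _) (fun w => hg _)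
  have e : ∑ w, g (w * x⁻¹) * g (w * y⁻¹) = ∑ u, g u * g (u * (x * y⁻¹)) := by
    rw [← Equiv.sum_comp (Equiv.mulRight x⁻¹) fun u => g u * g (u * (x * y⁻¹))]
    simp [mul_assoc]
  have t : ∀ a, ∑ w, g (w * a) = ∑ u, g u := fun a => Equiv.sum_comp (Equiv.mulRight a) g
  rw [h, e, t, t, card_univ, Nat.card_eq_fintype_card]
  ring

theorem four_mul_commonNeighbors_of_adj (hg : ∀ x, g x = 1 ∨ g x = -1) (h1 : g 1 = 1)
    (hinv : ∀ x, g x⁻¹ = g x) {x y : G} (hxy : (cayley (signSet g)).Adj x y) :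
    4 * (((cayley (signSet g)).commonNeighbors x y).ncard + 2 : ℤ) =
      Nat.card G + 2 * ∑ u, g u + ∑ u, g u * g (u * (x * y⁻¹)) := by
  classical
  rw [cayley_signSet_adj hinv] at hxy
  obtain ⟨hne, hxy⟩ := hxy
  have hyx : g (x * y⁻¹) = 1 := by rw [← hxy, ← hinv (y * x⁻¹)]; simp
  have e : insert x (insert y ((cayley (signSet g)).commonNeighbors x y)) =
      ({w | g (w * x⁻¹) = 1 ∧ g (w * y⁻¹) = 1} : Finset G) := by
    ext w
    by_cases hx : w = x
    · simp [hx, h1, hyx]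
    by_cases hy : w = y
    · simp [hy, h1, hxy]
    · simp [hx, hy, SimpleGraph.mem_commonNeighbors, cayley_signSet_adj hinv, Ne.symm hx,
        Ne.symm hy]
  have hc := congrArg Set.ncard e
  rw [Set.ncard_insert_of_notMem (by simp [SimpleGraph.mem_commonNeighbors, hne]),
    Set.ncard_insert_of_notMem (by simp [SimpleGraph.mem_commonNeighbors]),
    Set.ncard_coe_finset] at hc
  rw [← four_mul_card_filter_translates hg, ← hc]
  push_cast
  ring

theorem four_mul_commonNeighbors_of_not_adj (hg : ∀ x, g x = 1 ∨ g x = -1)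
    (hinv : ∀ x, g x⁻¹ = g x) {x y : G} (hne : x ≠ y) (hxy : ¬ (cayley (signSet g)).Adj x y) :
    4 * (((cayley (signSet g)).commonNeighbors x y).ncard : ℤ) =
      Nat.card G + 2 * ∑ u, g u + ∑ u, g u * g (u * (x * y⁻¹)) := by
  classical
  have hxy' : ¬ g (y * x⁻¹) = 1 := fun h => hxy ((cayley_signSet_adj hinv x y).2 ⟨hne, h⟩)
  have hyx : ¬ g (x * y⁻¹) = 1 := by rw [← hinv]; simpa using hxy'
  have e : (cayley (signSet g)).commonNeighbors x y =
      ({w | g (w * x⁻¹) = 1 ∧ g (w * y⁻¹) = 1} : Finset G) := by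
    ext w
    by_cases hx : w = x
    · simp [hx, hyx, SimpleGraph.mem_commonNeighbors]
    by_cases hy : w = y
    · simp [hy, hxy', SimpleGraph.mem_commonNeighbors]
    · simp [SimpleGraph.mem_commonNeighbors, cayley_signSet_adj hinv, Ne.symm hx, Ne.symm hy]
  rw [← four_mul_card_filter_translates hg, e, Set.ncard_coe_finset]

end SignFunctions

section Coordinates

theorem exists_linearEquiv_prod_apply_eq {M V : Type*} [AddCommGroup M] [Module (ZMod 2) M]
    [Finite M] [AddCommGroup V] [Module (ZMod 2) V] [Finite V]
    (hcard : Nat.card M = 2 * Nat.card V) {z : M} (hz : z ≠ 0) :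
    ∃ φ : M ≃ₗ[ZMod 2] ZMod 2 × V, φ z = (1, 0) := by
  obtain ⟨q, hq⟩ := Submodule.exists_isCompl (Submodule.span (ZMod 2) {z})
  let a := LinearEquiv.toSpanNonzeroSingleton (ZMod 2) M z hz
  let b := Submodule.prodEquivOfIsCompl _ q hq
  have hM : Nat.card M = 2 * Nat.card q := by
    rw [← Nat.card_congr b.toEquiv, Nat.card_prod, ← Nat.card_congr a.toEquiv]
    simp
  have hqV : Nat.card q = Nat.card V := by omega
  have hr : Module.finrank (ZMod 2) q = Module.finrank (ZMod 2) V := by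
    rw [Module.natCard_eq_pow_finrank (K := ZMod 2) (V := q),
      Module.natCard_eq_pow_finrank (K := ZMod 2) (V := V), Nat.card_zmod] at hqV
    exact Nat.pow_right_injective le_rfl hqV
  let c := LinearEquiv.ofFinrankEq q V hr
  refine ⟨b.symm.trans (a.symm.prodCongr c), ?_⟩
  have ha : a 1 = ⟨z, Submodule.mem_span_singleton_self z⟩ := by
    ext; simp [a]
  have hb : b.symm z = (a 1, 0) := by
    rw [LinearEquiv.symm_apply_eq, ha]
    simp [b]
  simp [hb]

/-- Coordinates identifying `G` with `ZMod 2 × ZMod 2 × V`, multiplication being addition twisted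
by the cocycle `t * σ x * σ y` in the second coordinate. -/
structure TwistedCoordinates (G V : Type*) [Group G] [AddCommGroup V] where
  t : ZMod 2
  σ : G → ZMod 2
  ε : G → ZMod 2
  ν : G → V
  bij : Function.Bijective fun x => (σ x, ε x, ν x)
  σ_mul : ∀ x y, σ (x * y) = σ x + σ y
  ν_mul : ∀ x y, ν (x * y) = ν x + ν y
  ε_mul : ∀ x y, ε (x * y) = ε x + ε y + t * σ x * σ y

theorem nonempty_twistedCoordinates {G V : Type*} [CommGroup G] [Finite G]
    [AddCommGroup V] [Module (ZMod 2) V] [Finite V] (hcard : Nat.card G = 4 * Nat.card V)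
    (H : Subgroup G) (hHidx : H.index = 2) (hHel : ∀ x ∈ H, x * x = 1) :
    Nonempty (TwistedCoordinates G V) := by
  classical
  have hV : 0 < Nat.card V := Nat.card_pos
  have hH : Nat.card H = 2 * Nat.card V := by
    have := H.index_mul_card
    rw [hHidx] at this
    omega
  let : Module (ZMod 2) (Additive H) := AddCommGroup.zmodModule (n := 2) fun x => by
    rw [two_nsmul]
    exact Subtype.ext (hHel x.toMul x.toMul.2)
  obtain ⟨s, hs⟩ : ∃ s, s ∉ H := by
    by_contra! h
    rw [(Subgroup.eq_top_iff' H).2 h] at hHidx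
    simp at hHidx
  have hmem := fun {a b : G} => Subgroup.mul_mem_iff_of_index_two hHidx (a := a) (b := b)
  have hss : s * s ∈ H := by simp [hmem]
  obtain ⟨z, t, hz, ht⟩ : ∃ (z : Additive H) (t : ZMod 2), z ≠ 0 ∧
      Additive.ofMul (⟨s * s, hss⟩ : H) = t • z := by
    by_cases h : Additive.ofMul (⟨s * s, hss⟩ : H) = 0
    · have : Nontrivial (Additive H) := by
        have : 1 < Nat.card H := by omega
        exact (Finite.one_lt_card_iff_nontrivial (α := H)).1 this
      obtain ⟨z, hz⟩ := exists_ne (0 : Additive H)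
      exact ⟨z, 0, hz, by simp [h]⟩
    · exact ⟨_, 1, h, by simp⟩
  obtain ⟨φ, hφ⟩ := exists_linearEquiv_prod_apply_eq (V := V) (M := Additive H) hH hz
  have hp : ∀ x, (if x ∈ H then x else s⁻¹ * x) ∈ H := by
    intro x
    split_ifs with h
    · exact h
    · simp [hmem, hs, h]
  let p : G → Additive H := fun x => Additive.ofMul ⟨_, hp x⟩
  let σ : G → ZMod 2 := fun x => if x ∈ H then 0 else 1
  have p_mul : ∀ x y, p (x * y) = p x + p y + (t * σ x * σ y) • z := by
    intro x y
    by_cases hx : x ∈ H <;> by_cases hy : y ∈ H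
    · simp only [σ, hx, hy, if_true, mul_zero, zero_smul, add_zero]
      apply Subtype.ext
      simp only [p, hx, hy, hmem, iff_self, if_true]
      rfl
    · simp only [σ, hx, hy, if_true, if_false, mul_zero, zero_mul, zero_smul, add_zero]
      apply Subtype.ext
      simp only [p, hx, hy, hmem, iff_false, not_true, if_true, if_false]
      exact mul_left_comm _ _ _
    · simp only [σ, hx, hy, if_true, if_false, mul_zero, zero_smul, add_zero]
      apply Subtype.ext
      simp only [p, hx, hy, hmem, iff_true, if_true, if_false]
      exact (mul_assoc _ _ _).symm
    · simp only [σ, hx, hy, if_false, mul_one, ← ht]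
      apply Subtype.ext
      simp only [p, hx, hy, hmem, iff_self, if_true, if_false]
      change x * y = s⁻¹ * x * (s⁻¹ * y) * (s * s)
      rw [mul_comm (s⁻¹ * x), mul_mul_mul_comm, mul_right_comm s⁻¹, mul_right_comm s⁻¹]
      simp [mul_comm x y]
  refine ⟨⟨t, σ, fun x => (φ (p x)).1, fun x => (φ (p x)).2, ?_, ?_, ?_, ?_⟩⟩
  · have hinj : Function.Injective fun x => (σ x, (φ (p x)).1, (φ (p x)).2) := by
      intro x y hxy
      simp only [Prod.mk.injEq] at hxy
      obtain ⟨h1, h2, h3⟩ := hxy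
      have h4 : p x = p y := φ.injective (Prod.ext h2 h3)
      have h5 := congrArg (fun a : Additive H => ((a.toMul : H) : G)) h4
      by_cases hx : x ∈ H <;> by_cases hy : y ∈ H <;> simp [σ, p, hx, hy] at h1 h5
      · exact h5
      · exact h5
    have := hinj.bijective_of_nat_card_le (by simp [hcard]; omega)
    exact this
  · intro x y
    by_cases hx : x ∈ H <;> by_cases hy : y ∈ H <;> simp [σ, hx, hy, hmem]
    decide
  · intro x y
    simp [p_mul, hφ]
  · intro x y
    simp [p_mul, hφ]

end Coordinates

section Signs

/-- The nontrivial character of `ZMod 2`. -/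
def zsign (a : ZMod 2) : ℤ := if a = 0 then 1 else -1

theorem zsign_add : ∀ a b, zsign (a + b) = zsign a * zsign b := by decide

theorem zsign_eq (a : ZMod 2) : zsign a = 1 ∨ zsign a = -1 := by
  revert a; decide

@[simp] theorem zsign_zero : zsign 0 = 1 := rfl

theorem sum_zsign_dotProduct {k : ℕ} (x : Fin k → ZMod 2) :
    ∑ y : Fin k → ZMod 2, zsign (x ⬝ᵥ y) = if x = 0 then 2 ^ k else 0 := by
  split_ifs with h
  · simp [h]
  · obtain ⟨i, hi⟩ : ∃ i, x i ≠ 0 := by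
      by_contra! h'
      exact h (funext h')
    have hi : x i = 1 := by
      generalize x i = a at hi
      revert a; decide
    have e := Equiv.sum_comp (Equiv.addRight (Pi.single i (1 : ZMod 2)))
      fun y : Fin k → ZMod 2 => zsign (x ⬝ᵥ y)
    have h1 : zsign 1 = -1 := rfl
    simp only [Equiv.coe_addRight, dotProduct_add, dotProduct_single, hi, mul_one, zsign_add, h1,
      mul_neg, sum_neg_distrib] at e
    omega

theorem sum_zsign_dotProduct_mul {k : ℕ} (x y : Fin k → ZMod 2) :
    ∑ w : (Fin k → ZMod 2) × (Fin k → ZMod 2),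
      zsign (w.1 ⬝ᵥ w.2) * zsign ((w.1 + x) ⬝ᵥ (w.2 + y)) =
        if x = 0 ∧ y = 0 then 2 ^ (2 * k) else 0 := by
  have hsq : ∀ a, zsign a * zsign a = 1 := by decide
  have e : ∀ w : (Fin k → ZMod 2) × (Fin k → ZMod 2),
      zsign (w.1 ⬝ᵥ w.2) * zsign ((w.1 + x) ⬝ᵥ (w.2 + y)) =
        zsign (x ⬝ᵥ y) * (zsign (y ⬝ᵥ w.1) * zsign (x ⬝ᵥ w.2)) := by
    intro w
    simp only [add_dotProduct, dotProduct_add, zsign_add, dotProduct_comm y w.1]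
    linear_combination (zsign (x ⬝ᵥ w.2) * zsign (w.1 ⬝ᵥ y) * zsign (x ⬝ᵥ y)) * hsq (w.1 ⬝ᵥ w.2)
  simp only [e]
  rw [← mul_sum, Fintype.sum_prod_type]
  simp only [← mul_sum, ← sum_mul, sum_zsign_dotProduct]
  by_cases hx : x = 0 <;> by_cases hy : y = 0 <;> simp [hx, hy]
  ring

/-- A pair of sign functions with opposite autocorrelations up to the sign `f₀`, both equal to `1`
on a subgroup `K` and balanced on its other cosets. -/
structure IsNeumaierPair {V : Type*} [AddCommGroup V] [Fintype V] [DecidableEq V]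
    (m : ℕ) (K : Finset V) (f₀ f₁ : V → ℤ) : Prop where
  sign₀ : ∀ v, f₀ v = 1 ∨ f₀ v = -1
  sign₁ : ∀ v, f₁ v = 1 ∨ f₁ v = -1
  zero_mem : 0 ∈ K
  add_mem : ∀ v ∈ K, ∀ w ∈ K, v + w ∈ K
  card : #K = m
  one₀ : ∀ v ∈ K, f₀ v = 1
  one₁ : ∀ v ∈ K, f₁ v = 1
  balanced₀ : ∀ v ∉ K, ∑ w ∈ K, f₀ (w + v) = 0
  balanced₁ : ∀ v ∉ K, ∑ w ∈ K, f₁ (w + v) = 0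
  sum₁ : ∑ v, f₁ v = m
  corr : ∀ v ≠ 0, ∑ w, f₁ w * f₁ (w + v) = -(f₀ v * ∑ w, f₀ w * f₀ (w + v))
  exists_corr : ∃ v ≠ 0, ∑ w, f₁ w * f₁ (w + v) ≠ 0
  exists_neg : ∃ v, f₁ v = -1

abbrev BinaryQuad := ZMod 2 × ZMod 2 × ZMod 2 × ZMod 2

def quadSign₀ (u : BinaryQuad) : ℤ :=
  zsign ((u.1 + u.2.1) * u.2.2.1 + u.1 * u.2.1 * u.2.2.2)

def quadSign₁ (u : BinaryQuad) : ℤ :=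
  zsign ((u.1 + u.2.1) * u.2.2.1 + (u.1 + u.2.1 + u.1 * u.2.1) * u.2.2.2 + u.1)

theorem isNeumaierPair_quadSign :
    IsNeumaierPair 4 ({u | u.1 = 0 ∧ u.2.1 = 0} : Finset BinaryQuad) quadSign₀ quadSign₁ where
  sign₀ _ := zsign_eq _
  sign₁ _ := zsign_eq _
  zero_mem := by decide
  add_mem := by decide +kernel
  card := by decide +kernel
  one₀ := by decide +kernel
  one₁ := by decide +kernel
  balanced₀ := by decide +kernel
  balanced₁ := by decide +kernel
  sum₁ := by decide +kernel
  corr := by decide +kernel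
  exists_corr := by decide +kernel
  exists_neg := by decide +kernel

theorem IsNeumaierPair.mul_zsign_dotProduct {U : Type*} [AddCommGroup U] [Fintype U]
    [DecidableEq U] {m : ℕ} {K : Finset U} {f₀ f₁ : U → ℤ} (h : IsNeumaierPair m K f₀ f₁) (k : ℕ) :
    IsNeumaierPair (V := U × (Fin k → ZMod 2) × (Fin k → ZMod 2)) (m * 2 ^ k)
      (K ×ˢ ({0} ×ˢ univ))
      (fun v => f₀ v.1 * zsign (v.2.1 ⬝ᵥ v.2.2)) (fun v => f₁ v.1 * zsign (v.2.1 ⬝ᵥ v.2.2)) := by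
  have hsign : ∀ f : U → ℤ, (∀ u, f u = 1 ∨ f u = -1) →
      ∀ v : U × (Fin k → ZMod 2) × (Fin k → ZMod 2),
        f v.1 * zsign (v.2.1 ⬝ᵥ v.2.2) = 1 ∨ f v.1 * zsign (v.2.1 ⬝ᵥ v.2.2) = -1 := by
    intro f hf v
    rcases hf v.1 with h1 | h1 <;> rcases zsign_eq (v.2.1 ⬝ᵥ v.2.2) with h2 | h2 <;> simp [h1, h2]
  have hbal : ∀ f : U → ℤ, (∀ v ∉ K, ∑ w ∈ K, f (w + v) = 0) →
      ∀ v ∉ K ×ˢ (({0} : Finset (Fin k → ZMod 2)) ×ˢ (univ : Finset (Fin k → ZMod 2))),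
        ∑ w ∈ K ×ˢ (({0} : Finset (Fin k → ZMod 2)) ×ˢ (univ : Finset (Fin k → ZMod 2))),
          f (w + v).1 * zsign ((w + v).2.1 ⬝ᵥ (w + v).2.2) = 0 := by
    rintro f hf ⟨u, x, y⟩ hv
    simp only [mem_product, mem_singleton, mem_univ, and_true, not_and] at hv
    rw [sum_product]
    simp only [Prod.mk_add_mk, ← mul_sum, ← sum_mul]
    by_cases hu : u ∈ K
    · rw [sum_product]
      simp [dotProduct_add, zsign_add, ← sum_mul, sum_zsign_dotProduct, hv hu]
    · simp [hf u hu]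
  have hcorr : ∀ f : U → ℤ, ∀ v : U × (Fin k → ZMod 2) × (Fin k → ZMod 2),
      ∑ w : U × (Fin k → ZMod 2) × (Fin k → ZMod 2),
        (f w.1 * zsign (w.2.1 ⬝ᵥ w.2.2)) * (f (w + v).1 * zsign ((w + v).2.1 ⬝ᵥ (w + v).2.2)) =
      (∑ u, f u * f (u + v.1)) * if v.2.1 = 0 ∧ v.2.2 = 0 then 2 ^ (2 * k) else 0 := by
    intro f v
    rw [← sum_zsign_dotProduct_mul, Fintype.sum_prod_type, sum_mul_sum]
    refine sum_congr rfl fun u _ => sum_congr rfl fun w _ => ?_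
    simp only [Prod.fst_add, Prod.snd_add]
    ring
  refine ⟨hsign _ h.sign₀, hsign _ h.sign₁, ?_, ?_, ?_, ?_, ?_, hbal _ h.balanced₀,
    hbal _ h.balanced₁, ?_, ?_, ?_, ?_⟩
  · simp [h.zero_mem]
  · rintro ⟨u, x, y⟩ hv ⟨u', x', y'⟩ hw
    simp only [mem_product, mem_singleton, mem_univ, and_true] at hv hw
    simp [hv.2, hw.2, h.add_mem u hv.1 u' hw.1]
  · simp [h.card]
  · rintro ⟨u, x, y⟩ hv
    simp only [mem_product, mem_singleton, mem_univ, and_true] at hv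
    simp [hv.2, h.one₀ u hv.1]
  · rintro ⟨u, x, y⟩ hv
    simp only [mem_product, mem_singleton, mem_univ, and_true] at hv
    simp [hv.2, h.one₁ u hv.1]
  · rw [Fintype.sum_prod_type]
    simp only [← mul_sum, ← sum_mul, h.sum₁, Fintype.sum_prod_type, sum_zsign_dotProduct]
    simp
  · rintro ⟨u, x, y⟩ hv
    rw [hcorr, hcorr]
    by_cases hxy : x = 0 ∧ y = 0
    · obtain ⟨rfl, rfl⟩ := hxy
      have hu : u ≠ 0 := fun h => hv (by simp [h])
      simp [h.corr u hu, mul_assoc]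
    · simp [hxy]
  · obtain ⟨u, hu, hc⟩ := h.exists_corr
    refine ⟨(u, 0, 0), by simp [hu], ?_⟩
    rw [hcorr]
    simpa using hc
  · obtain ⟨u, hu⟩ := h.exists_neg
    exact ⟨(u, 0, 0), by simp [hu]⟩

end Signs

namespace TwistedCoordinates

variable {G V : Type*} [Group G] [AddCommGroup V]

theorem twist_add_twist_mul : ∀ t a : ZMod 2, t * a + t * a * a = 0 := by decide

theorem zmod_two_mul_self : ∀ a : ZMod 2, a * a = a := by decide

section

variable (c : TwistedCoordinates G V)

@[simp] theorem σ_one : c.σ 1 = 0 := by simpa using c.σ_mul 1 1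

@[simp] theorem ν_one : c.ν 1 = 0 := by simpa using c.ν_mul 1 1

@[simp] theorem ε_one : c.ε 1 = 0 := by simpa using c.ε_mul 1 1

@[simp] theorem σ_inv (x : G) : c.σ x⁻¹ = c.σ x := by
  have h := c.σ_mul x⁻¹ x
  simp only [inv_mul_cancel, σ_one] at h
  exact (CharTwo.add_eq_zero.1 h.symm)

@[simp] theorem ν_inv (x : G) : c.ν x⁻¹ = -c.ν x := by
  have h := c.ν_mul x⁻¹ x
  simp only [inv_mul_cancel, ν_one] at h
  exact eq_neg_of_add_eq_zero_left h.symm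

@[simp] theorem ε_inv (x : G) : c.ε x⁻¹ = c.ε x + c.t * c.σ x := by
  have h := c.ε_mul x⁻¹ x
  simp only [inv_mul_cancel, ε_one, σ_inv, mul_assoc, zmod_two_mul_self] at h
  exact CharTwo.add_eq_zero.1 (by rw [h, add_assoc])

/-- The bijection onto the coordinate space. -/
noncomputable def equiv : G ≃ ZMod 2 × ZMod 2 × V := Equiv.ofBijective _ c.bij

theorem exists_coordinates (s e : ZMod 2) (v : V) : ∃ x, c.σ x = s ∧ c.ε x = e ∧ c.ν x = v := by
  obtain ⟨x, hx⟩ := c.bij.2 (s, e, v)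
  exact ⟨x, by simpa using hx⟩

theorem sum_comp [Fintype G] [Fintype V] (F : ZMod 2 → ZMod 2 → V → ℤ) :
    ∑ x, F (c.σ x) (c.ε x) (c.ν x) = ∑ s, ∑ e, ∑ v, F s e v := by
  rw [Fintype.sum_equiv c.equiv (fun x => F (c.σ x) (c.ε x) (c.ν x))
    (fun p => F p.1 p.2.1 p.2.2) fun x => rfl]
  simp [Fintype.sum_prod_type]

end

/-- The sign function on the coordinate space given by `±f₀` for `s = 0` and `f₁` for `s = 1`. -/
def joinSign (f₀ f₁ : V → ℤ) (s e : ZMod 2) (v : V) : ℤ :=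
  if s = 0 then zsign e * f₀ v else f₁ v

theorem sum_zmod_two {M : Type*} [AddCommMonoid M] (f : ZMod 2 → M) : ∑ a, f a = f 0 + f 1 :=
  Fin.sum_univ_two f

theorem zmod_two_eq_one : ∀ a : ZMod 2, a ≠ 0 → a = 1 := by decide

theorem neg_eq_self [Module (ZMod 2) V] (v : V) : -v = v := by
  have h : (-1 : ZMod 2) = 1 := by decide
  rw [← neg_one_smul (ZMod 2), h, one_smul]

theorem natCard_eq (c : TwistedCoordinates G V) : Nat.card G = 4 * Nat.card V := by
  rw [Nat.card_congr c.equiv]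
  simp
  ring

variable (c : TwistedCoordinates G V) {f₀ f₁ : V → ℤ}

theorem joinSign_inv [Module (ZMod 2) V] (x : G) :
    joinSign f₀ f₁ (c.σ x⁻¹) (c.ε x⁻¹) (c.ν x⁻¹) = joinSign f₀ f₁ (c.σ x) (c.ε x) (c.ν x) := by
  by_cases h : c.σ x = 0 <;> simp [joinSign, h, neg_eq_self]

variable [Fintype G] [Fintype V]

theorem sum_joinSign :
    ∑ x, joinSign f₀ f₁ (c.σ x) (c.ε x) (c.ν x) = 2 * ∑ v, f₁ v := by
  rw [c.sum_comp (joinSign f₀ f₁)]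
  have h1 : zsign 1 = -1 := rfl
  simp [sum_zmod_two, joinSign, h1]

theorem corr_joinSign (a : G) :
    ∑ x, joinSign f₀ f₁ (c.σ x) (c.ε x) (c.ν x) *
      joinSign f₀ f₁ (c.σ (x * a)) (c.ε (x * a)) (c.ν (x * a)) =
    if c.σ a = 0 then
      2 * (zsign (c.ε a) * (∑ v, f₀ v * f₀ (v + c.ν a)) + ∑ v, f₁ v * f₁ (v + c.ν a))
    else 0 := by
  simp only [c.σ_mul, c.ε_mul, c.ν_mul]
  rw [c.sum_comp fun s e v => joinSign f₀ f₁ s e v *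
    joinSign f₀ f₁ (s + c.σ a) (e + c.ε a + c.t * s * c.σ a) (v + c.ν a)]
  have h1 : zsign 1 = -1 := rfl
  split_ifs with h
  · simp only [sum_zmod_two, joinSign, h, h1, zsign_add, zsign_zero]
    simp only [mul_sum, ← sum_add_distrib]
    refine sum_congr rfl fun v _ => ?_
    simp
    ring
  · have h' := zmod_two_eq_one _ h
    have h2 : (1 : ZMod 2) + 1 = 0 := by decide
    simp only [sum_zmod_two, joinSign, h', h1, h2, zsign_add, zsign_zero]
    simp only [← sum_add_distrib]
    refine sum_eq_zero fun v _ => ?_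
    simp

/-- The elements with vanishing second coordinate whose third coordinate lies in `K`. -/
def cliqueSet [DecidableEq V] (K : Finset V) : Finset G := {x | c.ε x = 0 ∧ c.ν x ∈ K}

theorem sum_cliqueSet [DecidableEq V] (K : Finset V) (F : ZMod 2 → V → ℤ) :
    ∑ x ∈ c.cliqueSet K, F (c.σ x) (c.ν x) = ∑ v ∈ K, F 0 v + ∑ v ∈ K, F 1 v := by
  rw [cliqueSet, sum_filter, c.sum_comp fun s e v => if e = 0 ∧ v ∈ K then F s v else 0]
  simp [sum_zmod_two]

theorem card_cliqueSet [DecidableEq V] (K : Finset V) : #(c.cliqueSet K) = 2 * #K := by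
  have h := c.sum_cliqueSet K fun _ _ => 1
  simp only [sum_const, nsmul_eq_mul, mul_one] at h
  omega

variable [DecidableEq V] {m : ℕ} {K : Finset V}

theorem joinSign_eq (h : IsNeumaierPair m K f₀ f₁) (s e : ZMod 2) (v : V) :
    joinSign f₀ f₁ s e v = 1 ∨ joinSign f₀ f₁ s e v = -1 := by
  unfold joinSign
  split_ifs
  · rcases zsign_eq e with h1 | h1 <;> rcases h.sign₀ v with h2 | h2 <;> simp [h1, h2]
  · exact h.sign₁ v

theorem corr_joinSign_eq_zero (h : IsNeumaierPair m K f₀ f₁) {a : G} (ha : a ≠ 1)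
    (h1 : joinSign f₀ f₁ (c.σ a) (c.ε a) (c.ν a) = 1) :
    ∑ x, joinSign f₀ f₁ (c.σ x) (c.ε x) (c.ν x) *
      joinSign f₀ f₁ (c.σ (x * a)) (c.ε (x * a)) (c.ν (x * a)) = 0 := by
  rw [c.corr_joinSign]
  split_ifs with hσ
  · simp only [joinSign, hσ, if_true] at h1
    have hν : c.ν a ≠ 0 := by
      intro hν
      rw [hν, h.one₀ 0 h.zero_mem, mul_one] at h1
      have hε : c.ε a = 0 := by
        generalize c.ε a = b at h1
        revert b; decide
      exact ha (c.bij.1 (by simp [hσ, hε, hν]))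
    have hz : zsign (c.ε a) = f₀ (c.ν a) := by
      rcases zsign_eq (c.ε a) with h2 | h2 <;> rw [h2] at h1 ⊢ <;> omega
    rw [h.corr _ hν, hz]
    ring
  · rfl

variable [Module (ZMod 2) V]

theorem sum_translate_cliqueSet (h : IsNeumaierPair m K f₀ f₁) {x : G} (hx : x ∉ c.cliqueSet K) :
    ∑ w ∈ c.cliqueSet K,
      joinSign f₀ f₁ (c.σ (w * x⁻¹)) (c.ε (w * x⁻¹)) (c.ν (w * x⁻¹)) = 0 := by
  have h1 : zsign 1 = -1 := rfl
  have e : ∀ w ∈ c.cliqueSet K,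
      joinSign f₀ f₁ (c.σ (w * x⁻¹)) (c.ε (w * x⁻¹)) (c.ν (w * x⁻¹)) =
        if c.σ w = c.σ x then zsign (c.ε x) * f₀ (c.ν w + c.ν x) else f₁ (c.ν w + c.ν x) := by
    intro w hw
    simp only [cliqueSet, mem_filter, mem_univ, true_and] at hw
    by_cases hσ : c.σ w = c.σ x
    · simp [joinSign, c.σ_mul, c.ε_mul, c.ν_mul, hw.1, neg_eq_self, CharTwo.add_self_eq_zero, hσ,
        add_assoc, twist_add_twist_mul]
    · simp [joinSign, c.σ_mul, c.ν_mul, neg_eq_self, CharTwo.add_eq_zero, hσ]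
  rw [sum_congr rfl e, c.sum_cliqueSet K fun s v =>
    if s = c.σ x then zsign (c.ε x) * f₀ (v + c.ν x) else f₁ (v + c.ν x)]
  have key : zsign (c.ε x) * ∑ v ∈ K, f₀ (v + c.ν x) + ∑ v ∈ K, f₁ (v + c.ν x) = 0 := by
    by_cases hv : c.ν x ∈ K
    · have hε : c.ε x = 1 := zmod_two_eq_one _ fun h0 => hx (by simp [cliqueSet, h0, hv])
      rw [sum_congr rfl fun v hvK => h.one₀ _ (h.add_mem v hvK _ hv),
        sum_congr rfl fun v hvK => h.one₁ _ (h.add_mem v hvK _ hv), hε, h1]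
      ring
    · simp [h.balanced₀ _ hv, h.balanced₁ _ hv]
  rw [mul_sum] at key
  by_cases hσ : c.σ x = 0
  · simpa [hσ] using key
  · have hσ' := zmod_two_eq_one _ hσ
    simpa [hσ', add_comm] using key

/-- The connection set defined by a Neumaier pair. -/
abbrev connectionSet (f₀ f₁ : V → ℤ) : Set G :=
  signSet fun x => joinSign f₀ f₁ (c.σ x) (c.ε x) (c.ν x)

theorem isNeumaierWith (h : IsNeumaierPair m K f₀ f₁) (hV : Nat.card V = m ^ 2) (hm : 0 < m)
    {l : ℕ} (hl : l + 2 = m ^ 2 + m) :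
    IsNeumaierWith (cayley (c.connectionSet f₀ f₁)) (4 * m ^ 2) ((2 * m - 1) * (m + 1)) l
      m (2 * m) := by
  have hG : Nat.card G = 4 * m ^ 2 := by rw [c.natCard_eq, hV]
  have hg : ∀ x, joinSign f₀ f₁ (c.σ x) (c.ε x) (c.ν x) = 1 ∨
    joinSign f₀ f₁ (c.σ x) (c.ε x) (c.ν x) = -1 := fun x => joinSign_eq h _ _ _
  have hinv := c.joinSign_inv (f₀ := f₀) (f₁ := f₁)
  have h1 : joinSign f₀ f₁ (c.σ 1) (c.ε 1) (c.ν 1) = 1 := by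
    simp [joinSign, h.one₀ 0 h.zero_mem]
  have hsum := c.sum_joinSign (f₀ := f₀) (f₁ := f₁)
  rw [h.sum₁] at hsum
  refine ⟨?_, ⟨hG, ?_, ?_⟩, c.cliqueSet K, ⟨?_, ?_⟩, ?_⟩
  · intro htop
    obtain ⟨v, hv⟩ := h.exists_neg
    obtain ⟨x, hσ, -, hν⟩ := c.exists_coordinates 1 0 v
    have hx : x ≠ 1 := by rintro rfl; simp at hσ
    have hadj : (cayley (c.connectionSet f₀ f₁)).Adj 1 x := by
      rw [htop]; exact hx.symm
    rw [cayley_signSet_adj hinv] at hadj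
    simp [joinSign, hσ, hν, hv] at hadj
  · intro x
    have hd := two_mul_degree_cayley_signSet hg h1 hinv x
    rw [hsum, hG] at hd
    obtain ⟨j, rfl⟩ : ∃ j, m = j + 1 := ⟨m - 1, by omega⟩
    have e : 2 * (j + 1) - 1 = 2 * j + 1 := by omega
    rw [e]
    push_cast at hd
    zify
    linarith
  · intro x y hxy
    have hd := four_mul_commonNeighbors_of_adj hg h1 hinv hxy
    have hxy' := (cayley_signSet_adj hinv y x).1 hxy.symm
    rw [hsum, hG, c.corr_joinSign_eq_zero h (by simpa [mul_inv_eq_one] using hxy'.1.symm)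
      hxy'.2] at hd
    zify at hl ⊢
    push_cast at hd
    linarith
  · intro x hx y hy hxy
    rw [cayley_signSet_adj hinv]
    refine ⟨hxy, ?_⟩
    simp only [cliqueSet, coe_filter, mem_univ, true_and, Set.mem_ofPred_eq] at hx hy
    have hK := h.add_mem _ hy.2 _ hx.2
    simp only [joinSign, c.σ_mul, c.ε_mul, c.ν_mul, σ_inv, ε_inv, ν_inv, neg_eq_self, hx.1, hy.1,
      h.one₀ _ hK, h.one₁ _ hK, CharTwo.add_eq_zero]
    split_ifs with hσ
    · simp [hσ, twist_add_twist_mul]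
    · rfl
  · intro x hx
    have hd := two_mul_neighbors_inter hg hinv (C := c.cliqueSet K) (x := x) (by simpa using hx)
    rw [c.sum_translate_cliqueSet h (by simpa using hx), c.card_cliqueSet, h.card] at hd
    push_cast at hd
    zify
    linarith
  · rw [Set.ncard_coe_finset, c.card_cliqueSet, h.card]

theorem not_isStronglyRegular (h : IsNeumaierPair m K f₀ f₁) :
    ¬ IsStronglyRegular (cayley (c.connectionSet f₀ f₁)) := by
  rintro ⟨-, -, -, μ, hμ⟩
  have hg : ∀ x, joinSign f₀ f₁ (c.σ x) (c.ε x) (c.ν x) = 1 ∨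
    joinSign f₀ f₁ (c.σ x) (c.ε x) (c.ν x) = -1 := fun x => joinSign_eq h _ _ _
  have hinv := c.joinSign_inv (f₀ := f₀) (f₁ := f₁)
  have hconst : ∀ x, joinSign f₀ f₁ (c.σ x) (c.ε x) (c.ν x) = -1 → x ≠ 1 →
      4 * (μ : ℤ) = Nat.card G + 2 * ∑ u, joinSign f₀ f₁ (c.σ u) (c.ε u) (c.ν u) +
        ∑ u, joinSign f₀ f₁ (c.σ u) (c.ε u) (c.ν u) *
          joinSign f₀ f₁ (c.σ (u * x)) (c.ε (u * x)) (c.ν (u * x)) := by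
    intro x hx hx1
    have hadj : ¬ (cayley (c.connectionSet f₀ f₁)).Adj x 1 := by
      rw [SimpleGraph.adj_comm, cayley_signSet_adj hinv]
      simp [hx]
    have hd := four_mul_commonNeighbors_of_not_adj hg hinv hx1 hadj
    rw [hμ x 1 hx1 hadj] at hd
    simpa using hd
  obtain ⟨v, hv⟩ := h.exists_neg
  obtain ⟨x, hxσ, -, hxν⟩ := c.exists_coordinates 1 0 v
  have hx := hconst x (by simp [joinSign, hxσ, hxν, hv]) (by rintro rfl; simp at hxσ)
  obtain ⟨w, hw, hc⟩ := h.exists_corr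
  obtain ⟨e, he⟩ : ∃ e, zsign e = - f₀ w := by
    rcases h.sign₀ w with h0 | h0 <;> rw [h0]
    · exact ⟨1, rfl⟩
    · exact ⟨0, rfl⟩
  have hsq : f₀ w * f₀ w = 1 := by rcases h.sign₀ w with h0 | h0 <;> simp [h0]
  obtain ⟨y, hyσ, hyε, hyν⟩ := c.exists_coordinates 0 e w
  have hy := hconst y (by simp [joinSign, hyσ, hyε, hyν, he, hsq])
    (by rintro rfl; simp at hyν; exact hw hyν.symm)
  rw [c.corr_joinSign, hxσ] at hx
  rw [c.corr_joinSign, hyσ, hyε, hyν, he, neg_mul, ← h.corr w hw] at hy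
  simp only [one_ne_zero, if_true, if_false] at hx hy
  omega

end TwistedCoordinates

theorem statement2 (n : ℕ) (hpos : 0 < n) (hev : Even n)
    (G : Type*) [CommGroup G] [Finite G]
    (hG : Nat.card G = 2 ^ (2 * n + 2))
    (H : Subgroup G) (hHidx : H.index = 2) (hHel : ∀ x ∈ H, x * x = 1) :
    ∃ S : Set G, (1 : G) ∉ S ∧ S = S⁻¹ ∧
      IsNeumaierWith (cayley S) (2 ^ (2 * n + 2)) ((2 ^ (n + 1) - 1) * (2 ^ n + 1))
        (2 * (2 ^ n - 1) * (2 ^ (n - 1) + 1)) (2 ^ n) (2 ^ (n + 1)) ∧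
      ¬ IsStronglyRegular (cayley S) := by
  obtain ⟨k, rfl⟩ : ∃ k, n = k + 2 := ⟨n - 2, by obtain ⟨j, rfl⟩ := hev; omega⟩
  let := Fintype.ofFinite G
  have hp := isNeumaierPair_quadSign.mul_zsign_dotProduct k
  have hm : 4 * 2 ^ k = 2 ^ (k + 2) := by ring
  rw [hm] at hp
  have hV : Nat.card (BinaryQuad × (Fin k → ZMod 2) × (Fin k → ZMod 2)) = (2 ^ (k + 2)) ^ 2 := by
    simp [BinaryQuad]
    ring
  obtain ⟨c⟩ := nonempty_twistedCoordinates
    (V := BinaryQuad × (Fin k → ZMod 2) × (Fin k → ZMod 2))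
    (by rw [hG, hV]; ring) H hHidx hHel
  refine ⟨c.connectionSet _ _, by simp [signSet], signSet_inv c.joinSign_inv, ?_,
    c.not_isStronglyRegular hp⟩
  have hpow : 2 ^ (k + 2 - 1) = 2 * 2 ^ k := by
    rw [show k + 2 - 1 = k + 1 by omega]; ring
  have hN := c.isNeumaierWith hp hV (by positivity)
    (l := 2 * (2 ^ (k + 2) - 1) * (2 ^ (k + 2 - 1) + 1)) (by
      rw [hpow, ← hm]
      have : 0 < 2 ^ k := by positivity
      generalize 2 ^ k = q at *
      obtain ⟨j, rfl⟩ : ∃ j, q = j + 1 := ⟨q - 1, by omega⟩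
      rw [show 4 * (j + 1) - 1 = 4 * j + 3 by omega]
      ring)
  rwa [show 4 * (2 ^ (k + 2)) ^ 2 = 2 ^ (2 * (k + 2) + 2) by ring,
    show 2 * 2 ^ (k + 2) = 2 ^ (k + 2 + 1) by ring] at hN
end

section
/- For every prime p there exist a finite group G whose order is divisible by p and a subset S ⊆ G with e ∉ S and S = S⁻¹ such that the Cayley graph Cay(G,S) is a strictly Neumaier graph (i.e. a non-complete edge-regular graph containing an m-regular clique for some m ≥ 1 that is not strongly regular). -/
/-- The central extension of `V` by `H` with cocycle a biadditive map `ω`. -/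
@[ext]
structure BiadditiveExtension {V H : Type} [AddCommGroup V] [AddCommGroup H]
    (ω : V →+ V →+ H) where
  /-- The component in the quotient `V`. -/
  base : V
  /-- The component in the central subgroup `H`. -/
  fiber : H

namespace BiadditiveExtension

variable {V H : Type} [AddCommGroup V] [AddCommGroup H] {ω : V →+ V →+ H}

instance : Mul (BiadditiveExtension ω) :=
  ⟨fun a b => ⟨a.base + b.base, a.fiber + b.fiber + ω a.base b.base⟩⟩

instance : One (BiadditiveExtension ω) := ⟨⟨0, 0⟩⟩

instance : Inv (BiadditiveExtension ω) :=
  ⟨fun a => ⟨-a.base, -a.fiber + ω a.base a.base⟩⟩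

@[simp] lemma base_one : (1 : BiadditiveExtension ω).base = 0 := rfl
@[simp] lemma fiber_one : (1 : BiadditiveExtension ω).fiber = 0 := rfl
@[simp] lemma base_mul (a b : BiadditiveExtension ω) : (a * b).base = a.base + b.base := rfl
@[simp] lemma fiber_mul (a b : BiadditiveExtension ω) :
    (a * b).fiber = a.fiber + b.fiber + ω a.base b.base := rfl
@[simp] lemma base_inv (a : BiadditiveExtension ω) : a⁻¹.base = -a.base := rfl
@[simp] lemma fiber_inv (a : BiadditiveExtension ω) :
    a⁻¹.fiber = -a.fiber + ω a.base a.base := rfl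

instance : Group (BiadditiveExtension ω) :=
  Group.ofLeftAxioms
    (fun a b c => by
      ext
      · simp [add_assoc]
      · simp only [fiber_mul, base_mul, map_add, AddMonoidHom.add_apply]
        abel)
    (fun a => by ext <;> simp)
    (fun a => by ext <;> simp)

/-- The underlying set of the extension is the product. -/
def equivProd (ω : V →+ V →+ H) : BiadditiveExtension ω ≃ V × H where
  toFun a := (a.base, a.fiber)
  invFun a := ⟨a.1, a.2⟩

instance [Finite V] [Finite H] : Finite (BiadditiveExtension ω) :=
  Finite.of_equiv _ (equivProd ω).symm

/-- The union of the central fiber and the zero section, without the identity. -/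
def axes (ω : V →+ V →+ H) : Set (BiadditiveExtension ω) :=
  {g | (g.base = 0 ∧ g.fiber ≠ 0) ∨ (g.base ≠ 0 ∧ g.fiber = 0)}

lemma one_notMem_axes : (1 : BiadditiveExtension ω) ∉ axes ω := by
  simp [axes]

lemma axes_eq_inv (hω : ∀ x, ω x x = 0) : axes ω = (axes ω)⁻¹ := by
  ext g
  simp [axes, hω]

lemma map_swap (hω : ∀ x, ω x x = 0) (x y : V) : ω x y = -ω y x := by
  have h := hω (x + y)
  simp only [map_add, AddMonoidHom.add_apply, hω, zero_add, add_zero] at h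
  rw [eq_neg_iff_add_eq_zero, add_comm]
  exact h

lemma cayley_axes_adj (hω : ∀ x, ω x x = 0) (a b : BiadditiveExtension ω) :
    (cayley (axes ω)).Adj a b ↔
      (a.base = b.base ∧ a.fiber ≠ b.fiber) ∨
        (a.base ≠ b.base ∧ b.fiber = a.fiber + ω b.base a.base) := by
  have key : ∀ a b : BiadditiveExtension ω, b * a⁻¹ ∈ axes ω ↔
      (a.base = b.base ∧ a.fiber ≠ b.fiber) ∨
        (a.base ≠ b.base ∧ b.fiber = a.fiber + ω b.base a.base) := by
    intro a b
    have h1 : b.base + -a.base = 0 ↔ a.base = b.base := by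
      rw [← sub_eq_add_neg, sub_eq_zero, eq_comm]
    have h2 : b.fiber + -a.fiber + -ω b.base a.base = 0 ↔
        b.fiber = a.fiber + ω b.base a.base := by
      rw [← sub_eq_zero (a := b.fiber)]
      constructor <;> intro h <;> rw [← h] <;> abel
    simp only [axes, Set.mem_ofPred_eq, base_mul, base_inv, fiber_mul, fiber_inv, hω, add_zero,
      map_neg, ne_eq, h1, h2]
    refine or_congr (and_congr_right fun h => not_congr ?_) Iff.rfl
    rw [h, hω, add_zero, eq_comm]
  rw [cayley, SimpleGraph.fromRel_adj, key a b, key b a]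
  constructor
  · rintro ⟨-, h | ⟨h, h'⟩ | ⟨h, h'⟩⟩
    · exact h
    · exact Or.inl ⟨h.symm, h'.symm⟩
    · refine Or.inr ⟨h.symm, ?_⟩
      rw [h', map_swap hω a.base b.base]
      abel
  · intro h
    refine ⟨?_, Or.inl h⟩
    rintro rfl
    simp at h

lemma ncard_neighborSet_cayley_axes [Finite V] [Finite H] (hω : ∀ x, ω x x = 0)
    (a : BiadditiveExtension ω) :
    ((cayley (axes ω)).neighborSet a).ncard = Nat.card H - 1 + (Nat.card V - 1) := by
  have h : (cayley (axes ω)).neighborSet a =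
      (fun u => ⟨a.base, u⟩) '' {a.fiber}ᶜ ∪
        (fun z => ⟨z, a.fiber + ω z a.base⟩) '' {a.base}ᶜ := by
    ext b
    rw [SimpleGraph.mem_neighborSet, cayley_axes_adj hω]
    constructor
    · rintro (⟨h, h'⟩ | ⟨h, h'⟩)
      · exact Or.inl ⟨b.fiber, h'.symm, by ext; exacts [h, rfl]⟩
      · exact Or.inr ⟨b.base, Ne.symm h, by ext; exacts [rfl, h'.symm]⟩
    · rintro (⟨u, h, rfl⟩ | ⟨z, h, rfl⟩)
      · exact Or.inl ⟨rfl, Ne.symm h⟩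
      · exact Or.inr ⟨Ne.symm h, rfl⟩
  rw [h, Set.ncard_union_eq, Set.ncard_image_of_injective, Set.ncard_image_of_injective,
    Set.ncard_compl, Set.ncard_compl, Set.ncard_singleton, Set.ncard_singleton]
  · exact fun z w h => congrArg base h
  · exact fun z w h => congrArg fiber h
  · rw [Set.disjoint_left]
    rintro _ ⟨u, -, rfl⟩ ⟨z, hz, h⟩
    exact hz (congrArg base h)

lemma ncard_commonNeighbors_cayley_axes [Finite V] [Finite H] (hω : ∀ x, ω x x = 0)
    (hker : ∀ q, q ≠ 0 → {z | ω z q = 0}.ncard = Nat.card H)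
    {a b : BiadditiveExtension ω} (hab : (cayley (axes ω)).Adj a b) :
    ((cayley (axes ω)).commonNeighbors a b).ncard = Nat.card H - 2 := by
  rw [cayley_axes_adj hω] at hab
  obtain ⟨x, s⟩ := a
  obtain ⟨y, t⟩ := b
  rcases hab with ⟨h, h'⟩ | ⟨h, h'⟩
  · simp only at h h'
    subst h
    have hset : (cayley (axes ω)).commonNeighbors ⟨x, s⟩ ⟨x, t⟩ =
        (fun u => ⟨x, u⟩) '' {s, t}ᶜ := by
      ext ⟨z, u⟩
      rw [SimpleGraph.mem_commonNeighbors, cayley_axes_adj hω, cayley_axes_adj hω]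
      simp only [Set.mem_image, Set.mem_compl_iff, Set.mem_insert_iff, Set.mem_singleton_iff,
        BiadditiveExtension.mk.injEq]
      constructor
      · intro h
        refine ⟨u, ?_, ?_, rfl⟩ <;> grind
      · rintro ⟨w, hw, rfl, rfl⟩
        grind
    rw [hset, Set.ncard_image_of_injective _ fun z w h => congrArg fiber h, Set.ncard_compl,
      Set.ncard_pair h']
  · simp only at h h'
    subst h'
    have hset : (cayley (axes ω)).commonNeighbors ⟨x, s⟩ ⟨y, s + ω y x⟩ =
        (fun z => ⟨z + y, s + ω (z + y) x⟩) '' ({z | ω z (x - y) = 0} \ {0, x - y}) := by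
      ext ⟨z, u⟩
      rw [SimpleGraph.mem_commonNeighbors, cayley_axes_adj hω, cayley_axes_adj hω]
      simp only [Set.mem_image, Set.mem_sdiff, Set.mem_insert_iff, Set.mem_singleton_iff,
        Set.mem_ofPred_eq, BiadditiveExtension.mk.injEq, map_sub]
      constructor
      · rintro ⟨⟨h1, h2⟩ | ⟨h1, h2⟩, ⟨h3, h4⟩ | ⟨h3, h4⟩⟩
        · exact absurd (h1.trans h3.symm) h
        · subst h1
          refine absurd ?_ h2
          rw [h4, map_swap hω x y]
          abel
        · subst h3
          exact absurd h2.symm h4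
        · refine ⟨z - y, ⟨?_, ?_⟩, by abel, ?_⟩
          · rw [h2] at h4
            simp only [map_sub, AddMonoidHom.sub_apply, hω]
            rw [← sub_eq_zero] at h4
            exact Eq.trans (by abel) h4
          · rw [sub_eq_zero, sub_left_inj]
            rintro (h5 | h5)
            exacts [h3 h5.symm, h1 h5.symm]
          · rw [sub_add_cancel, h2]
      · rintro ⟨w, ⟨h1, h2⟩, rfl, rfl⟩
        push Not at h2
        refine ⟨Or.inr ⟨fun h3 => h2.2 (eq_sub_of_add_eq h3.symm), rfl⟩,
          Or.inr ⟨fun h3 => h2.1 (by simpa using h3), ?_⟩⟩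
        simp only [map_add, AddMonoidHom.add_apply, hω]
        rw [sub_eq_zero.mp h1]
        abel
    have hxy : x - y ≠ 0 := sub_ne_zero.mpr h
    rw [hset, Set.ncard_image_of_injective _ fun z w h => add_right_cancel (congrArg base h),
      Set.ncard_sdiff, hker _ hxy, Set.ncard_pair hxy.symm]
    rintro z (rfl | rfl)
    exacts [by simp, hω _]

lemma isRegularClique_fiber (hω : ∀ x, ω x x = 0) :
    IsRegularClique (cayley (axes ω)) {a | a.base = 0} 1 := by
  refine ⟨fun a ha b hb hab => ?_, fun a ha => ?_⟩
  · rw [cayley_axes_adj hω]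
    refine Or.inl ⟨ha.trans hb.symm, fun h => hab ?_⟩
    ext
    exacts [ha.trans hb.symm, h]
  · rw [Set.ncard_eq_one]
    refine ⟨⟨0, a.fiber⟩, ?_⟩
    ext ⟨y, t⟩
    rw [Set.mem_inter_iff, SimpleGraph.mem_neighborSet, cayley_axes_adj hω, Set.mem_singleton_iff,
      BiadditiveExtension.mk.injEq]
    simp only [Set.mem_ofPred_eq] at ha ⊢
    constructor
    · rintro ⟨⟨h, -⟩ | ⟨-, h⟩, rfl⟩
      · exact absurd h ha
      · simpa using h
    · rintro ⟨rfl, rfl⟩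
      exact ⟨Or.inr ⟨ha, by simp⟩, rfl⟩

lemma mem_commonNeighbors_one (hω : ∀ x, ω x x = 0) {q : V} (hq : q ≠ 0) {t : H} (ht : t ≠ 0)
    (a : BiadditiveExtension ω) :
    a ∈ (cayley (axes ω)).commonNeighbors 1 ⟨q, t⟩ ↔
      a = ⟨0, t⟩ ∨ a = ⟨q, 0⟩ ∨ (a.fiber = 0 ∧ ω q a.base = t) := by
  obtain ⟨z, u⟩ := a
  rw [SimpleGraph.mem_commonNeighbors, cayley_axes_adj hω, cayley_axes_adj hω,
    BiadditiveExtension.mk.injEq, BiadditiveExtension.mk.injEq, map_swap hω q z,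
    neg_eq_iff_add_eq_zero]
  simp only [base_one, fiber_one, map_zero, add_zero]
  constructor
  · rintro ⟨⟨h1, h2⟩ | ⟨h1, h2⟩, ⟨h3, h4⟩ | ⟨h3, h4⟩⟩
    · exact absurd (h3.trans h1.symm) hq
    · subst h1
      exact Or.inl ⟨rfl, by simpa using h4⟩
    · exact Or.inr (Or.inl ⟨h3.symm, h2⟩)
    · exact Or.inr (Or.inr ⟨h2, by rw [add_comm, ← h4, h2]⟩)
  · rintro (⟨rfl, rfl⟩ | ⟨rfl, rfl⟩ | ⟨rfl, h⟩)
    · exact ⟨Or.inl ⟨rfl, ht.symm⟩, Or.inr ⟨hq, by simp⟩⟩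
    · exact ⟨Or.inr ⟨hq.symm, rfl⟩, Or.inl ⟨rfl, ht⟩⟩
    · refine ⟨Or.inr ⟨?_, rfl⟩, Or.inr ⟨?_, by rw [add_comm, h]⟩⟩
      · rintro rfl
        exact ht (by simpa using h)
      · rintro rfl
        exact ht (by simpa [hω] using h)

lemma not_adj_one (hω : ∀ x, ω x x = 0) {q : V} (hq : q ≠ 0) {t : H} (ht : t ≠ 0) :
    (1 : BiadditiveExtension ω) ≠ ⟨q, t⟩ ∧ ¬ (cayley (axes ω)).Adj 1 ⟨q, t⟩ := by
  refine ⟨fun h => hq (congrArg base h).symm, ?_⟩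
  rw [cayley_axes_adj hω]
  simp [hq.symm, ht]

lemma not_isStronglyRegular_cayley_axes [Finite V] [Finite H] (hω : ∀ x, ω x x = 0)
    {q z : V} {t : H} (hz : ω q z ≠ 0) (ht : t ∉ (ω q).range) :
    ¬ IsStronglyRegular (cayley (axes ω)) := by
  rintro ⟨-, -, -, μ, hμ⟩
  have hq : q ≠ 0 := by
    rintro rfl
    simp at hz
  have ht0 : t ≠ 0 := by
    rintro rfl
    exact ht (zero_mem _)
  have h1 := hμ _ _ (not_adj_one hω hq ht0).1 (not_adj_one hω hq ht0).2
  have h2 := hμ _ _ (not_adj_one hω hq hz).1 (not_adj_one hω hq hz).2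
  have hle : μ ≤ 2 := by
    rw [← h1]
    refine (Set.ncard_le_ncard (t := {⟨0, t⟩, ⟨q, 0⟩}) fun a ha => ?_).trans
      (Set.ncard_insert_le _ _ |>.trans (by simp))
    rcases (mem_commonNeighbors_one hω hq ht0 a).mp ha with h | h | h
    exacts [Or.inl h, Or.inr h, absurd ⟨_, h.2⟩ ht]
  have hge : 2 < μ := by
    rw [← h2, Set.two_lt_ncard_iff]
    refine ⟨⟨0, ω q z⟩, ⟨q, 0⟩, ⟨z, 0⟩, ?_, ?_, ?_, ?_, ?_, ?_⟩
    · exact (mem_commonNeighbors_one hω hq hz _).mpr (Or.inl rfl)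
    · exact (mem_commonNeighbors_one hω hq hz _).mpr (Or.inr (Or.inl rfl))
    · exact (mem_commonNeighbors_one hω hq hz _).mpr (Or.inr (Or.inr ⟨rfl, rfl⟩))
    · exact fun h => hq (congrArg base h).symm
    · exact fun h => hz (congrArg fiber h)
    · intro h
      rw [← show q = z from congrArg base h] at hz
      exact hz (hω q)
  omega

end BiadditiveExtension

/-- The standard symplectic form on `F⁴`. -/
def symplecticForm (F : Type) [CommRing F] :
    (F × F × F × F) →ₗ[F] (F × F × F × F) →ₗ[F] F :=
  LinearMap.mk₂ F
    (fun x y => x.1 * y.2.1 - x.2.1 * y.1 + (x.2.2.1 * y.2.2.2 - x.2.2.2 * y.2.2.1))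
    (fun x y z => by simp only [Prod.fst_add, Prod.snd_add]; ring)
    (fun c x y => by simp only [Prod.smul_fst, Prod.smul_snd, smul_eq_mul]; ring)
    (fun x y z => by simp only [Prod.fst_add, Prod.snd_add]; ring)
    (fun c x y => by simp only [Prod.smul_fst, Prod.smul_snd, smul_eq_mul]; ring)

lemma symplecticForm_apply {F : Type} [CommRing F] (x y : F × F × F × F) :
    symplecticForm F x y =
      x.1 * y.2.1 - x.2.1 * y.1 + (x.2.2.1 * y.2.2.2 - x.2.2.2 * y.2.2.1) := rfl

lemma ncard_symplecticForm_eq_zero {F : Type} [Field F] [Finite F] {q : F × F × F × F}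
    (hq : q ≠ 0) : {z | symplecticForm F z q = 0}.ncard = Nat.card F ^ 3 := by
  let φ : Module.Dual F (F × F × F × F) := (symplecticForm F).flip q
  have hφ : φ ≠ 0 := by
    intro h
    have h' : ∀ z, symplecticForm F z q = 0 := fun z => LinearMap.congr_fun h z
    have h1 := h' (1, 0, 0, 0)
    have h2 := h' (0, 1, 0, 0)
    have h3 := h' (0, 0, 1, 0)
    have h4 := h' (0, 0, 0, 1)
    simp [symplecticForm_apply] at h1 h2 h3 h4
    exact hq (by ext <;> simp [*])
  have hfin := Module.Dual.finrank_ker_add_one_of_ne_zero hφ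
  have hdim : Module.finrank F (F × F × F × F) = 4 := by simp
  have hker : Module.finrank F (LinearMap.ker φ) = 3 := by omega
  have hcard := Module.natCard_eq_pow_finrank (K := F) (V := LinearMap.ker φ)
  rw [hker] at hcard
  exact hcard

/-- The symplectic form on `F⁴` viewed as taking values in the first factor of `F³`. -/
def symplecticCocycle (F : Type) [CommRing F] :
    (F × F × F × F) →+ (F × F × F × F) →+ (F × F × F) :=
  AddMonoidHom.mk'
    (fun x => (AddMonoidHom.inl F (F × F)).comp (symplecticForm F x).toAddMonoidHom)
    (fun x y => by ext z <;> simp)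

lemma symplecticCocycle_apply {F : Type} [CommRing F] (x y : F × F × F × F) :
    symplecticCocycle F x y = (symplecticForm F x y, 0, 0) := rfl

theorem statement8 (p : ℕ) (hp : p.Prime) :
    ∃ (G : Type) (_ : Group G) (_ : Finite G),
      p ∣ Nat.card G ∧
      ∃ S : Set G, (1 : G) ∉ S ∧ S = S⁻¹ ∧
        cayley S ≠ ⊤ ∧
        (∃ v k l, IsEdgeRegularWith (cayley S) v k l) ∧
        (∃ (m : ℕ) (C : Set G), 1 ≤ m ∧ IsRegularClique (cayley S) C m) ∧
        ¬ IsStronglyRegular (cayley S) := by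
  open BiadditiveExtension in
  have : Fact p.Prime := ⟨hp⟩
  let ω := symplecticCocycle (ZMod p)
  have hω : ∀ x, ω x x = 0 := fun x => by
    simp only [ω, symplecticCocycle_apply, symplecticForm_apply, Prod.mk_eq_zero, and_true]
    ring
  have hker : ∀ q, q ≠ 0 →
      {z | ω z q = 0}.ncard = Nat.card (ZMod p × ZMod p × ZMod p) := fun q hq => by
    simp only [ω, symplecticCocycle_apply, Prod.mk_eq_zero, and_true]
    rw [ncard_symplecticForm_eq_zero hq, Nat.card_prod, Nat.card_prod]
    ring
  have hz : ω (1, 0, 0, 0) (0, 1, 0, 0) ≠ 0 := by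
    simp [ω, symplecticCocycle_apply, symplecticForm_apply]
  have ht : (0, 1, 0) ∉ (ω (1, 0, 0, 0)).range := by
    rintro ⟨z, h⟩
    simp [ω, symplecticCocycle_apply] at h
  refine ⟨BiadditiveExtension ω, inferInstance, inferInstance, ?_, axes ω, one_notMem_axes,
    axes_eq_inv hω, ?_, ⟨_, _, _, rfl, ncard_neighborSet_cayley_axes hω,
      fun _ _ => ncard_commonNeighbors_cayley_axes hω hker⟩,
    ⟨1, _, le_rfl, isRegularClique_fiber hω⟩, not_isStronglyRegular_cayley_axes hω hz ht⟩
  · rw [Nat.card_congr (equivProd ω), Nat.card_prod, Nat.card_prod, Nat.card_zmod, mul_assoc]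
    exact dvd_mul_right _ _
  · intro h
    have hne := not_adj_one hω (q := (1, 0, 0, 0)) (by simp) hz
    exact hne.2 (h ▸ hne.1)
end

section
/- In the Construction 2 setup: if the subgroup {e} × H₀ of G₀ = A₀ × H₀ is an (m₀/2)-regular clique of size m₀ in Γ₀ = Cay(G₀,S₀), then the subgroup {e} × H₀ × C of G = A × H₀ × C is an m₀-regular clique of size 2m₀ in Γ = Cay(G,S). -/
/-- `T` is a relative difference set in `K` relative to the (forbidden)
subgroup `N` with multiplicity `lam`. -/
def IsRDS {K : Type*} [Group K] (N : Subgroup K) (T : Set K) (lam : ℕ) : Prop :=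
  (∀ g : K, g ∉ N → {p : K × K | p.1 ∈ T ∧ p.2 ∈ T ∧ p.1 * p.2⁻¹ = g}.ncard = lam) ∧
  ∀ g ∈ N, g ≠ 1 → ¬∃ t₁ ∈ T, ∃ t₂ ∈ T, t₁ * t₂⁻¹ = g

theorem cayley_adj_iff {G : Type*} [Group G] {S : Set G} (hS : ∀ g ∈ S, g⁻¹ ∈ S) {x y : G} :
    (cayley S).Adj x y ↔ x ≠ y ∧ y * x⁻¹ ∈ S := by
  rw [cayley, SimpleGraph.fromRel_adj]
  refine and_congr_right fun _ => ⟨?_, Or.inl⟩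
  rintro (h | h)
  · exact h
  · simpa using hS _ h

/-- In a Cayley graph on `A × K`, a vertex outside `{1} × K` has as many neighbours in `{1} × K`
as there are elements of the connection set above the inverse of its first coordinate. -/
theorem ncard_cayley_neighborSet_inter {A K : Type*} [Group A] [Group K] {S : Set (A × K)}
    (hS : ∀ g ∈ S, g⁻¹ ∈ S) {x : A × K} (hx : x.1 ≠ 1) :
    ((cayley S).neighborSet x ∩ {p | p.1 = 1}).ncard = {t : K | (x.1⁻¹, t) ∈ S}.ncard := by
  have himage : (cayley S).neighborSet x ∩ {p | p.1 = 1} =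
      (fun t : K => ((1 : A), t * x.2)) '' {t : K | (x.1⁻¹, t) ∈ S} := by
    ext ⟨a, k⟩
    simp only [Set.mem_inter_iff, SimpleGraph.mem_neighborSet, cayley_adj_iff hS,
      Set.mem_ofPred_eq, Set.mem_image, Prod.mk.injEq]
    constructor
    · rintro ⟨⟨-, h⟩, rfl⟩
      exact ⟨k * x.2⁻¹, by simpa [Prod.mul_def] using h, rfl, by simp⟩
    · rintro ⟨t, h, rfl, rfl⟩
      exact ⟨⟨fun e => hx (congrArg Prod.fst e), by simpa [Prod.mul_def] using h⟩, rfl⟩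
  rw [himage, Set.ncard_image_of_injective]
  intro s t h
  simpa using h

theorem ncard_setOf_fst_eq_one {A K : Type*} [One A] :
    {p : A × K | p.1 = 1}.ncard = Nat.card K := by
  have himage : {p : A × K | p.1 = 1} = (fun k : K => ((1 : A), k)) '' Set.univ := by
    ext ⟨a, k⟩
    simp [eq_comm]
  rw [himage, Set.ncard_image_of_injective _ (Prod.mk_right_injective 1), Set.ncard_univ]

theorem statement9
    {A : Type*} [CommGroup A] [Finite A]
    (A₀ : Subgroup A) (hA₀nt : A₀ ≠ ⊥) (hA₀idx : A₀.index = 2)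
    {H₀ : Type*} [CommGroup H₀] [Finite H₀] [Nontrivial H₀]
    {C : Type*} [Group C] [Finite C] (hC : Nat.card C = 2) (c : C) (hc : c ≠ 1)
    (m₀ : ℕ) (hm₀ : m₀ = Nat.card H₀) (hm₀even : Even m₀)
    (S₀ : Set (↥A₀ × H₀)) (hS₀e : (1 : ↥A₀ × H₀) ∉ S₀) (hS₀inv : S₀ = S₀⁻¹)
    (hS₀A : ∀ p ∈ S₀, p.2 ≠ (1 : H₀))
    (T : Set (H₀ × C)) (hTrev : T = T⁻¹) (hTcard : T.ncard = m₀)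
    (hTrds : IsRDS ((⊥ : Subgroup H₀).prod (⊤ : Subgroup C)) T (m₀ / 2))
    (S : Set (A × H₀ × C))
    (hSdef : S = {p : A × H₀ × C | p.1 ∉ A₀ ∧ p.2 ∈ T} ∪
        {p : A × H₀ × C | ∃ h : p.1 ∈ A₀, ((⟨p.1, h⟩ : ↥A₀), p.2.1) ∈ S₀} ∪
        {((1 : A), (1 : H₀), c)})
    (hclique₀ : IsRegularClique (cayley S₀) {p : ↥A₀ × H₀ | p.1 = 1} (m₀ / 2))
    (hclsize₀ : {p : ↥A₀ × H₀ | p.1 = 1}.ncard = m₀) :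
    IsRegularClique (cayley S) {p : A × H₀ × C | p.1 = 1} m₀ ∧
    {p : A × H₀ × C | p.1 = 1}.ncard = 2 * m₀ := by
  have hC_eq : ∀ x : C, x ≠ 1 → x = c := by
    obtain ⟨u, v, -, huv⟩ := Nat.card_eq_two_iff.mp hC
    have hmem : ∀ z : C, z = u ∨ z = v := fun z => by
      have hz : z ∈ ({u, v} : Set C) := huv ▸ Set.mem_univ z
      simpa using hz
    intro x hx
    have h₁ := hmem 1
    have h₂ := hmem x
    have h₃ := hmem c
    grind
  have hS₀ : ∀ g ∈ S₀, g⁻¹ ∈ S₀ := fun g hg => Set.mem_inv.mp (hS₀inv ▸ hg)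
  have hT : ∀ t ∈ T, t⁻¹ ∈ T := fun t ht => Set.mem_inv.mp (hTrev ▸ ht)
  have hS : ∀ g ∈ S, g⁻¹ ∈ S := by
    subst hSdef
    rintro ⟨a, t⟩ ((⟨ha, ht⟩ | ⟨ha, hs⟩) | h)
    · exact Or.inl (Or.inl ⟨fun h => ha (inv_mem_iff.mp h), hT _ ht⟩)
    · exact Or.inl (Or.inr ⟨inv_mem ha, hS₀ _ hs⟩)
    · right
      rw [Set.mem_singleton_iff] at h ⊢
      rw [h, Prod.inv_mk, Prod.inv_mk, inv_one, inv_one, hC_eq c⁻¹ (inv_ne_one.mpr hc)]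
  have hsub : ∀ h : H₀, h ≠ 1 → ((1 : ↥A₀), h) ∈ S₀ := by
    intro h hh
    have hadj := hclique₀.1 (x := ((1 : ↥A₀), (1 : H₀))) rfl (y := ((1 : ↥A₀), h)) rfl
      (fun e => hh (congrArg Prod.snd e).symm)
    simpa using ((cayley_adj_iff hS₀).mp hadj).2
  refine ⟨⟨?_, ?_⟩, ?_⟩
  · rintro ⟨a, h, x⟩ (rfl : a = 1) ⟨b, k, y⟩ (rfl : b = 1) hne
    refine (cayley_adj_iff hS).mpr ⟨hne, ?_⟩
    rw [hSdef]
    by_cases hk : k * h⁻¹ = 1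
    · right
      have hyx : y * x⁻¹ ≠ 1 := fun e => hne (by
        rw [mul_inv_eq_one.mp hk, mul_inv_eq_one.mp e])
      simp [hk, hC_eq _ hyx]
    · refine Or.inl (Or.inr ⟨by simp, ?_⟩)
      convert hsub _ hk using 2
      · exact Subtype.ext (mul_inv_cancel 1)
      · rfl
  · rintro ⟨a, t⟩ (ha : a ≠ 1)
    rw [ncard_cayley_neighborSet_inter hS ha]
    by_cases haA : a ∈ A₀
    · have hprod : {t : H₀ × C | (a⁻¹, t) ∈ S} =
          {h : H₀ | ((⟨a, haA⟩ : ↥A₀)⁻¹, h) ∈ S₀} ×ˢ (Set.univ : Set C) := by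
        ext ⟨h, x⟩
        simp [hSdef, haA, ha]
        rfl
      have hne : (⟨a, haA⟩ : ↥A₀) ≠ 1 := fun e => ha (congrArg Subtype.val e)
      have hcount := hclique₀.2 ((⟨a, haA⟩ : ↥A₀), (1 : H₀)) hne
      rw [ncard_cayley_neighborSet_inter hS₀ hne] at hcount
      rw [hprod, Set.ncard_prod, Set.ncard_univ, hC, hcount,
        Nat.div_mul_cancel hm₀even.two_dvd]
    · have hfib : {t : H₀ × C | (a⁻¹, t) ∈ S} = T := by
        ext t
        simp [hSdef, haA, ha]
      rw [hfib, hTcard]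
  · rw [ncard_setOf_fst_eq_one, Nat.card_prod, hC, ← hm₀, mul_comm]
end
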